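/- For each p ∈ (1,∞) and each r ∈ (2,∞) there exists a constant C_{p,r} > 0, independent of the dimension d ∈ ℤ_+, such that for every d ∈ ℤ_+ and every f ∈ ℓ^p(ℤ^d) one has ‖ V^r(G_t f : t>0) ‖_{ℓ^p(ℤ^d)} ≤ C_{p,r} ‖f‖_{ℓ^p(ℤ^d)}. -/

import Mathlib

open scoped ENNReal Real BigOperators
open Real

/-- The one-dimensional Theta function `θ_t(ζ) = Σ_{k∈ℤ} exp(-π(k-ζ)²t)`. -/
noncomputable def theta (t ζ : ℝ) : ℝ :=
  ∑' k : ℤ, Real.exp (-π * ((k : ℝ) - ζ) ^ 2 * t)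

/-- The d-dimensional Theta function `Θ_t(ξ) = Π_j θ_t(ξ_j)`. -/
noncomputable def bigTheta (d : ℕ) (t : ℝ) (ξ : Fin d → ℝ) : ℝ :=
  ∏ j, theta t (ξ j)

/-- The discrete normalized Gaussian kernel `g_t(n) = Θ_{1/t}(0)⁻¹ exp(-π|n|²/t)`. -/
noncomputable def gauss (d : ℕ) (t : ℝ) (n : Fin d → ℤ) : ℝ :=
  (bigTheta d (1 / t) 0)⁻¹ * Real.exp (-π * (∑ j, ((n j : ℝ)) ^ 2) / t)

/-- The convolution operator `G_t f(x) = Σ_n g_t(n) f(x-n)` on ℤ^d. -/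
noncomputable def gConv (d : ℕ) (t : ℝ) (f : (Fin d → ℤ) → ℂ) (x : Fin d → ℤ) : ℂ :=
  ∑' n : Fin d → ℤ, (gauss d t n : ℂ) * f (x - n)

/-- The ℓ^p norm (valued in ℝ≥0∞) of an ℝ≥0∞-valued function on ℤ^d. -/
noncomputable def lpNorm (d : ℕ) (p : ℝ) (F : (Fin d → ℤ) → ℝ≥0∞) : ℝ≥0∞ :=
  (∑' x : Fin d → ℤ, F x ^ p) ^ (1 / p)

/-- The r-variation seminorm `V^r(a_t : t ∈ I)`: supremum over all finite increasing sequences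
`t_0 < … < t_J` in `I` of `(Σ_{j<J} |a_{t_{j+1}} - a_{t_j}|^r)^{1/r}`. -/
noncomputable def variationSeminorm (a : ℝ → ℂ) (I : Set ℝ) (r : ℝ) : ℝ≥0∞ :=
  ⨆ (J : ℕ) (u : Fin (J + 1) → ℝ) (_ : StrictMono u) (_ : ∀ j, u j ∈ I),
    (∑ j : Fin J, (‖a (u j.succ) - a (u j.castSucc)‖₊ : ℝ≥0∞) ^ r) ^ (1 / r)

namespace VG

noncomputable def rmax (x : ℕ → ℝ) : ℕ → ℝ
  | 0 => x 0
  | n+1 => max (rmax x n) (x (n+1))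

noncomputable def samp (ε : ℝ) (x : ℕ → ℝ) : ℕ → ℝ
  | 0 => x 0
  | n+1 => if ε * rmax x (n+1) < |x (n+1) - samp ε x n| then x (n+1) else samp ε x n

lemma rmax_mono (x : ℕ → ℝ) : Monotone (rmax x) :=
  monotone_nat_of_le_succ fun n => by simp [rmax]

lemma le_rmax_self (x : ℕ → ℝ) (n : ℕ) : x n ≤ rmax x n := by
  cases n <;> simp [rmax]

lemma le_rmax (x : ℕ → ℝ) {i n : ℕ} (h : i ≤ n) : x i ≤ rmax x n :=
  (le_rmax_self x i).trans (rmax_mono x h)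

lemma rmax_nonneg {x : ℕ → ℝ} (hx : ∀ n, 0 ≤ x n) (n : ℕ) : 0 ≤ rmax x n :=
  (hx n).trans (le_rmax_self x n)

lemma rmax_congr {x y : ℕ → ℝ} : ∀ {n : ℕ}, (∀ i ≤ n, x i = y i) → rmax x n = rmax y n
  | 0, h => h 0 le_rfl
  | n+1, h => by
    simp only [rmax]
    rw [rmax_congr (n := n) (fun i hi => h i (by omega)), h (n+1) le_rfl]

lemma samp_congr (ε : ℝ) {x y : ℕ → ℝ} :
    ∀ {n : ℕ}, (∀ i ≤ n, x i = y i) → samp ε x n = samp ε y n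
  | 0, h => h 0 le_rfl
  | n+1, h => by
    simp only [samp]
    rw [samp_congr ε (n := n) (fun i hi => h i (by omega)), h (n+1) le_rfl, rmax_congr h]

lemma samp_nonneg {ε : ℝ} {x : ℕ → ℝ} (hx : ∀ n, 0 ≤ x n) : ∀ n, 0 ≤ samp ε x n
  | 0 => hx 0
  | n+1 => by
    simp only [samp]; split_ifs
    · exact hx _
    · exact samp_nonneg hx n

lemma samp_le {ε : ℝ} {x : ℕ → ℝ} : ∀ n, samp ε x n ≤ rmax x n
  | 0 => le_rfl
  | n+1 => by
    simp only [samp]; split_ifs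
    · exact le_rmax_self _ _
    · exact (samp_le n).trans (rmax_mono x (Nat.le_succ n))

lemma samp_close {ε : ℝ} (hε : 0 ≤ ε) {x : ℕ → ℝ} (hx : ∀ n, 0 ≤ x n) (n : ℕ) :
    |x n - samp ε x n| ≤ ε * rmax x n := by
  have h0 : 0 ≤ ε * rmax x n := mul_nonneg hε (rmax_nonneg hx n)
  cases n with
  | zero => simpa [samp] using h0
  | succ n =>
    simp only [samp]; split_ifs with h
    · simpa using h0
    · exact not_lt.1 h

lemma samp_jump {ε : ℝ} {x : ℕ → ℝ} {n : ℕ} (h : samp ε x (n+1) ≠ samp ε x n) :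
    samp ε x (n+1) = x (n+1) ∧ ε * rmax x (n+1) < |samp ε x (n+1) - samp ε x n| := by
  have e : samp ε x (n+1) = if ε * rmax x (n+1) < |x (n+1) - samp ε x n| then x (n+1)
    else samp ε x n := rfl
  by_cases hc : ε * rmax x (n+1) < |x (n+1) - samp ε x n|
  · rw [if_pos hc] at e
    exact ⟨e, by rw [e]; exact hc⟩
  · rw [if_neg hc] at e; exact absurd e h

lemma exists_scale {y R : ℝ} (hy : 0 < y) (hyR : y ≤ R) :
    ∃ k : ℕ, 4 * (1/2:ℝ)^k * R ≤ y ∧ y ≤ 8 * (1/2:ℝ)^k * R := by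
  have hR : 0 < R := hy.trans_le hyR
  have hex : ∃ k : ℕ, 4 * (1/2:ℝ)^k * R ≤ y := by
    obtain ⟨k, hk⟩ := exists_pow_lt_of_lt_one (show 0 < y / (4 * R) by positivity)
      (show (1/2:ℝ) < 1 by norm_num)
    refine ⟨k, ?_⟩
    rw [lt_div_iff₀ (by positivity)] at hk
    nlinarith
  classical
  refine ⟨Nat.find hex, Nat.find_spec hex, ?_⟩
  rcases h : Nat.find hex with _ | k
  · simp; linarith
  · have := Nat.find_min hex (m := k) (by omega)
    rw [not_le] at this
    rw [pow_succ]; linarith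

/-- weighted square functions -/
noncomputable def wsq (r : ℝ) (K : ℕ) (x : ℕ → ℝ) (n : ℕ) : ℝ :=
  ∑ k ∈ Finset.range K, ((1/2:ℝ)^k)^(r-2) *
    ∑ m ∈ Finset.range n, (samp ((1/2:ℝ)^k) x (m+1) - samp ((1/2:ℝ)^k) x m)^2

noncomputable def pot (r : ℝ) (K N : ℕ) (x : ℕ → ℝ) (n : ℕ) : ℝ :=
  2 * (rmax x n)^r + 256 * 8^(r-2) * (rmax x N)^(r-2) * wsq r K x n

lemma wsq_sub (r : ℝ) (K : ℕ) (x : ℕ → ℝ) {i j : ℕ} (hij : i ≤ j) :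
    wsq r K x j - wsq r K x i = ∑ k ∈ Finset.range K, ((1/2:ℝ)^k)^(r-2) *
    ∑ m ∈ Finset.Ico i j, (samp ((1/2:ℝ)^k) x (m+1) - samp ((1/2:ℝ)^k) x m)^2 := by
  simp only [wsq, ← Finset.sum_sub_distrib, ← mul_sub]
  refine Finset.sum_congr rfl fun k _ => ?_
  rw [Finset.sum_Ico_eq_sub _ hij]

lemma wsq_mono (r : ℝ) (K : ℕ) (x : ℕ → ℝ) : Monotone (wsq r K x) := by
  intro i j hij
  rw [← sub_nonneg, wsq_sub r K x hij]
  exact Finset.sum_nonneg fun k _ => mul_nonneg (by positivity)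
    (Finset.sum_nonneg fun m _ => sq_nonneg _)

lemma wsq_zero (r : ℝ) (K : ℕ) (x : ℕ → ℝ) : wsq r K x 0 = 0 := by simp [wsq]

lemma wsq_nonneg (r : ℝ) (K : ℕ) (x : ℕ → ℝ) (n : ℕ) : 0 ≤ wsq r K x n := by
  rw [← wsq_zero r K x]; exact wsq_mono r K x (Nat.zero_le n)

lemma pathwise_pair {r : ℝ} (hr : 2 < r) {x : ℕ → ℝ} (hx : ∀ n, 0 ≤ x n) {N i j : ℕ}
    (hij : i ≤ j) (hjN : j ≤ N) :
    ∀ᶠ K in Filter.atTop, |x j - x i|^r ≤ pot r K N x j - pot r K N x i := by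
  have hRi := rmax_nonneg hx i
  have hRj := rmax_nonneg hx j
  have hRN := rmax_nonneg hx N
  have hRij := rmax_mono x hij
  have hRjN := rmax_mono x hjN
  have hRr : (rmax x i)^r ≤ (rmax x j)^r := Real.rpow_le_rpow hRi hRij (by linarith)
  have hdiff : ∀ K, 0 ≤ 256 * 8^(r-2) * (rmax x N)^(r-2) * (wsq r K x j - wsq r K x i) := by
    intro K
    exact mul_nonneg (by positivity) (sub_nonneg.2 (wsq_mono r K x hij))
  have habs : |x j - x i| ≤ rmax x j := by
    rw [abs_le]
    have := le_rmax_self x j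
    have := le_rmax x hij
    have := hx i
    have := hx j
    constructor <;> linarith
  by_cases h0 : x j = x i
  · refine Filter.Eventually.of_forall fun K => ?_
    rw [h0, sub_self, abs_zero, Real.zero_rpow (by linarith)]
    have := hdiff K
    simp only [pot]; linarith
  by_cases hd : rmax x i < rmax x j / 2
  · refine Filter.Eventually.of_forall fun K => ?_
    have h1 : |x j - x i|^r ≤ (rmax x j)^r := Real.rpow_le_rpow (abs_nonneg _) habs (by linarith)
    have h2 : (rmax x i)^r ≤ (rmax x j / 2)^r := Real.rpow_le_rpow hRi hd.le (by linarith)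
    rw [Real.div_rpow hRj (by norm_num)] at h2
    have h3 : (2:ℝ) ≤ 2^r := by
      calc (2:ℝ) = 2^(1:ℝ) := by simp
        _ ≤ 2^r := Real.rpow_le_rpow_of_exponent_le (by norm_num) (by linarith)
    have h4 : (rmax x j)^r / 2^r ≤ (rmax x j)^r / 2 :=
      div_le_div_of_nonneg_left (by positivity) (by norm_num) h3
    have := hdiff K
    simp only [pot]; linarith
  · rw [not_lt] at hd
    have hy : 0 < |x j - x i| := abs_pos.2 (sub_ne_zero.2 h0)
    obtain ⟨k, hk1, hk2⟩ := exists_scale hy habs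
    set ε : ℝ := (1/2:ℝ)^k with hε
    have hεp : 0 < ε := by positivity
    have hjump : ∃ m ∈ Finset.Ico i j, samp ε x (m+1) ≠ samp ε x m := by
      by_contra hcon
      push Not at hcon
      have : ∀ l, i ≤ l → l ≤ j → samp ε x l = samp ε x i := by
        intro l hil
        induction l, hil using Nat.le_induction with
        | base => intro _; rfl
        | succ l hl ih =>
          intro hlj
          rw [hcon l (Finset.mem_Ico.2 ⟨hl, by omega⟩)]
          exact ih (by omega)
      have e := this j hij le_rfl
      have c1 := samp_close hεp.le hx i
      have c2 := samp_close hεp.le hx j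
      rw [e] at c2
      have : |x j - x i| ≤ |x j - samp ε x i| + |x i - samp ε x i| := by
        rw [abs_sub_comm (x i)]; exact abs_sub_le _ _ _
      have : ε * rmax x i ≤ ε * rmax x j := by gcongr
      nlinarith
    obtain ⟨m, hm, hmj⟩ := hjump
    have hjs := (samp_jump hmj).2
    rw [Finset.mem_Ico] at hm
    have hRm : rmax x i ≤ rmax x (m+1) := rmax_mono x (by omega)
    have hbig : |x j - x i| ≤ 16 * |samp ε x (m+1) - samp ε x m| := by
      have : ε * (rmax x j / 2) ≤ ε * rmax x (m+1) := by gcongr; linarith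
      nlinarith
    filter_upwards [Filter.eventually_gt_atTop k] with K hK
    have hw : ε^(r-2) * (samp ε x (m+1) - samp ε x m)^2 ≤ wsq r K x j - wsq r K x i := by
      rw [wsq_sub r K x hij]
      refine le_trans ?_ (Finset.single_le_sum (f := fun k => ((1/2:ℝ)^k)^(r-2) *
        ∑ m ∈ Finset.Ico i j, (samp ((1/2:ℝ)^k) x (m+1) - samp ((1/2:ℝ)^k) x m)^2)
        (fun k _ => mul_nonneg (by positivity) (Finset.sum_nonneg fun m _ => sq_nonneg _))
        (Finset.mem_range.2 hK))
      refine mul_le_mul_of_nonneg_left ?_ (by positivity)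
      exact Finset.single_le_sum (f := fun m => (samp ε x (m+1) - samp ε x m)^2)
        (fun m _ => sq_nonneg _) (Finset.mem_Ico.2 hm)
    have h1 : |x j - x i|^r = |x j - x i|^2 * |x j - x i|^(r-2) := by
      rw [← Real.rpow_natCast, ← Real.rpow_add hy]; norm_num
    have h2 : |x j - x i|^(2:ℕ) ≤ 256 * (samp ε x (m+1) - samp ε x m)^2 := by
      rw [← sq_abs (samp ε x (m+1) - samp ε x m)]
      nlinarith [abs_nonneg (x j - x i)]
    have h3 : |x j - x i|^(r-2) ≤ 8^(r-2) * ε^(r-2) * (rmax x N)^(r-2) := by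
      rw [← Real.mul_rpow (by norm_num) hεp.le, ← Real.mul_rpow (by positivity) hRN]
      refine Real.rpow_le_rpow hy.le (hk2.trans ?_) (by linarith)
      gcongr
    have h4 : |x j - x i|^r ≤ 256 * 8^(r-2) * (rmax x N)^(r-2) *
        (ε^(r-2) * (samp ε x (m+1) - samp ε x m)^2) := by
      rw [h1]
      refine (mul_le_mul h2 h3 (by positivity) (by positivity)).trans (le_of_eq (by ring))
    have h5 : 256 * 8^(r-2) * (rmax x N)^(r-2) *
        (ε^(r-2) * (samp ε x (m+1) - samp ε x m)^2) ≤ 256 * 8^(r-2) * (rmax x N)^(r-2) *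
        (wsq r K x j - wsq r K x i) := mul_le_mul_of_nonneg_left hw (by positivity)
    simp only [pot]; linarith

lemma pathwise {r : ℝ} (hr : 2 < r) {x : ℕ → ℝ} (hx : ∀ n, 0 ≤ x n) (N : ℕ) :
    ∀ᶠ K in Filter.atTop, ∀ J (u : Fin (J+1) → ℕ), StrictMono u → (∀ j, u j ≤ N) →
      ∑ j : Fin J, |x (u j.succ) - x (u j.castSucc)|^r ≤ pot r K N x N := by
  have h : ∀ᶠ K in Filter.atTop, ∀ j ∈ Finset.range (N+1), ∀ i ∈ Finset.range (j+1),
      |x j - x i|^r ≤ pot r K N x j - pot r K N x i := by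
    rw [Filter.eventually_all_finset]
    intro j hj
    rw [Filter.eventually_all_finset]
    intro i hi
    rw [Finset.mem_range] at hi hj
    exact pathwise_pair hr hx (by omega) (by omega)
  filter_upwards [h] with K hK J u hu huN
  have hRN := rmax_nonneg hx N
  have hpm : pot r K N x (u (Fin.last J)) ≤ pot r K N x N := by
    have := rmax_mono x (huN (Fin.last J))
    have := rmax_nonneg hx (u (Fin.last J))
    have := wsq_mono r K x (huN (Fin.last J))
    simp only [pot]; gcongr
  have hp0 : 0 ≤ pot r K N x (u 0) := by
    have := rmax_nonneg hx (u 0)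
    have := wsq_nonneg r K x (u 0)
    simp only [pot]; positivity
  calc _ ≤ ∑ j : Fin J, (pot r K N x (u j.succ) - pot r K N x (u j.castSucc)) := by
        refine Finset.sum_le_sum fun j _ => hK _ ?_ _ ?_
        · have := huN j.succ; rw [Finset.mem_range]; omega
        · have := hu (Fin.castSucc_lt_succ (i := j)); rw [Finset.mem_range]; omega
    _ = pot r K N x (u (Fin.last J)) - pot r K N x (u 0) := by
        rw [Finset.sum_sub_distrib]
        have e1 := Fin.sum_univ_succ (fun j => pot r K N x (u j))
        have e2 := Fin.sum_univ_castSucc (fun j => pot r K N x (u j))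
        linarith
    _ ≤ _ := by linarith

end VG

namespace VG

lemma young_lem {p : ℝ} (hp : 1 < p) {s x : ℝ} (hs : 0 ≤ s) (hx : 0 ≤ x) :
    p * s^(p-1) * x ≤ (p-1) * s^p + x^p := by
  have hpq : p.HolderConjugate (p/(p-1)) := Real.HolderConjugate.conjExponent hp
  have h := Real.young_inequality_of_nonneg hx (Real.rpow_nonneg hs (p-1)) hpq
  rw [← Real.rpow_mul hs, mul_div_cancel₀ _ (by linarith : p - 1 ≠ 0)] at h
  have hp0 : 0 < p := by linarith
  have hp1 : 0 < p - 1 := by linarith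
  have e : p * (x^p / p + s^p / (p/(p-1))) = (p-1) * s^p + x^p := by
    field_simp; ring
  calc _ = p * (x * s^(p-1)) := by ring
    _ ≤ _ := by rw [← e]; gcongr

lemma young_scaled {p l : ℝ} (hp : 1 < p) (hl : 0 < l) {s x : ℝ} (hs : 0 ≤ s) (hx : 0 ≤ x) :
    p * s^(p-1) * x ≤ (p-1)/l * s^p + l^(p-1) * x^p := by
  have h := young_lem hp hs (mul_nonneg hl.le hx)
  rw [Real.mul_rpow hl.le hx] at h
  have e : l^p = l * l^(p-1) := by
    rw [← Real.rpow_one_add' hl.le (by linarith)]; congr 1; ring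
  rw [e] at h
  have e2 : l * ((p-1)/l * s^p + l^(p-1) * x^p) = (p-1) * s^p + l * l^(p-1) * x^p := by
    field_simp
  refine le_of_mul_le_mul_left ?_ hl
  rw [e2]; linarith

lemma rpow_lin {q : ℝ} (hq : 0 < q) (hq1 : q ≤ 1) {a b : ℝ} (ha : 0 ≤ a) (hab : a ≤ b)
    (hb : b ≤ 1) : q * (b - a) ≤ b^q - a^q := by
  rcases hab.eq_or_lt with rfl | hlt
  · simp
  obtain ⟨c, hc, he⟩ := exists_hasDerivAt_eq_slope (fun x : ℝ => x^q) (fun x => q * x^(q-1)) hlt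
    (fun x _ => (Real.continuousAt_rpow_const x q (Or.inr hq.le)).continuousWithinAt)
    (fun x hx => Real.hasDerivAt_rpow_const (Or.inl (ne_of_gt (lt_of_le_of_lt ha hx.1))))
  rw [eq_div_iff (by linarith)] at he
  rw [← he]
  have : 1 ≤ c^(q-1) := Real.one_le_rpow_of_pos_of_le_one_of_nonpos
    (lt_of_le_of_lt ha hc.1) (hc.2.le.trans hb) (by linarith)
  have h2 : q * 1 ≤ q * c^(q-1) := by gcongr
  nlinarith

lemma breg_one {p : ℝ} (hp : 1 < p) (hp2 : p ≤ 2) {a b : ℝ} (ha : 0 ≤ a) (ha1 : a ≤ 1)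
    (hb : 0 ≤ b) (hb1 : b ≤ 1) :
    p*(p-1)/2 * (b-a)^2 ≤ b^p - a^p - p * a^(p-1) * (b-a) := by
  have hder : ∀ x : ℝ, HasDerivAt (fun x : ℝ => x^p - p*(p-1)/2 * x^2)
      (p * x^(p-1) - p*(p-1)*x) x := by
    intro x
    have h1 := Real.hasDerivAt_rpow_const (x := x) (p := p) (Or.inr hp.le)
    have h2 := ((hasDerivAt_pow 2 x).const_mul (p*(p-1)/2))
    refine (h1.sub h2).congr_deriv ?_
    simp; ring
  have hcont : Continuous (fun x : ℝ => x^p - p*(p-1)/2 * x^2) :=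
    continuous_iff_continuousAt.2 fun x => (hder x).continuousAt
  rcases lt_trichotomy a b with h | rfl | h
  · obtain ⟨c, hc, he⟩ := exists_hasDerivAt_eq_slope _ _ h hcont.continuousOn
      (fun x _ => hder x)
    rw [eq_div_iff (by linarith)] at he
    have hl := rpow_lin (q := p-1) (by linarith) (by linarith) ha hc.1.le (hc.2.le.trans hb1)
    have hl2 : p * ((p-1) * (c-a)) ≤ p * (c^(p-1) - a^(p-1)) := by gcongr
    nlinarith
  · simp
  · obtain ⟨c, hc, he⟩ := exists_hasDerivAt_eq_slope _ _ h hcont.continuousOn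
      (fun x _ => hder x)
    rw [eq_div_iff (by linarith)] at he
    have hl := rpow_lin (q := p-1) (by linarith) (by linarith) (hb.trans hc.1.le) hc.2.le ha1
    have hl2 : p * ((p-1) * (a-c)) ≤ p * (a^(p-1) - c^(p-1)) := by gcongr
    nlinarith

lemma breg_low {p : ℝ} (hp : 1 < p) (hp2 : p ≤ 2) {a b s : ℝ} (ha : 0 ≤ a) (has : a ≤ s)
    (hb : 0 ≤ b) (hbs : b ≤ s) :
    p*(p-1)/2 * ((b-a)^2 * s^(p-2)) ≤ b^p - a^p - p * a^(p-1) * (b-a) := by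
  rcases (ha.trans has).eq_or_lt with h0 | hs
  · have : a = 0 := by linarith
    have : b = 0 := by linarith
    subst_vars
    simp
  have h := breg_one hp hp2 (div_nonneg ha hs.le) ((div_le_one hs).2 has)
    (div_nonneg hb hs.le) ((div_le_one hs).2 hbs)
  rw [Real.div_rpow hb hs.le, Real.div_rpow ha hs.le, Real.div_rpow ha hs.le] at h
  have e1 : s^(p-1) = s^p / s := Real.rpow_sub_one hs.ne' p
  have e2 : s^(p-2) = s^p / s^2 := by
    rw [Real.rpow_sub hs]; norm_num
  have hsp : 0 < s^p := Real.rpow_pos_of_pos hs p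
  rw [e1] at h
  have h' := mul_le_mul_of_nonneg_left h hsp.le
  rw [e2]
  have el : s^p * (p*(p-1)/2 * (b/s - a/s)^2) = p*(p-1)/2 * ((b-a)^2 * (s^p/s^2)) := by
    field_simp
  have er : s^p * (b^p/s^p - a^p/s^p - p * (a^(p-1)/(s^p/s)) * (b/s-a/s)) =
      b^p - a^p - p * a^(p-1) * (b-a) := by
    field_simp
  rw [el, er] at h'
  exact h'

lemma breg_nonneg {p : ℝ} (hp : 1 < p) {a b : ℝ} (ha : 0 ≤ a) (hb : 0 ≤ b) :
    0 ≤ b^p - a^p - p * a^(p-1) * (b-a) := by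
  have h := young_lem hp ha hb
  have e : a^p = a^(p-1) * a := by
    rw [← Real.rpow_add_one' ha (by linarith)]; congr 1; ring
  have : p * a^(p-1) * (b-a) = p * a^(p-1) * b - p * a^p := by rw [e]; ring
  linarith

section mart
variable {Ω : Type} [Fintype Ω] (μ : Ω → ℝ) (X : Ω → ℕ → ℝ) (N : ℕ)

def Mart : Prop := ∀ n < N, ∀ h : (ℕ → ℝ) → ℝ,
  (∀ x y : ℕ → ℝ, (∀ i ≤ n, x i = y i) → h x = h y) →
  ∑ ω, μ ω * (h (X ω) * (X ω (n+1) - X ω n)) = 0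

variable {μ X N}

lemma doob {p : ℝ} (hp : 1 < p) (hμ : ∀ ω, 0 ≤ μ ω) (hX : ∀ ω n, 0 ≤ X ω n)
    (hM : Mart μ X N) :
    ∑ ω, μ ω * (rmax (X ω) N)^p ≤ 2^p/(p-1) * ∑ ω, μ ω * (X ω N)^p := by
  have key : ∀ n ≤ N, ∑ ω, μ ω * ((p-1) * (rmax (X ω) n)^p -
      p * (rmax (X ω) n)^(p-1) * X ω n) ≤ 0 := by
    intro n
    induction n with
    | zero =>
      intro _
      refine Finset.sum_nonpos fun ω _ => ?_
      have e : (X ω 0)^p = (X ω 0)^(p-1) * X ω 0 := by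
        rw [← Real.rpow_add_one' (hX ω 0) (by linarith)]; congr 1; ring
      simp only [rmax]
      rw [e]
      have : 0 ≤ (X ω 0)^(p-1) * X ω 0 := mul_nonneg (Real.rpow_nonneg (hX ω 0) _) (hX ω 0)
      exact mul_nonpos_of_nonneg_of_nonpos (hμ ω) (by nlinarith)
    | succ n ih =>
      intro hn
      have h1 := ih (by omega)
      have h2 := hM n (by omega) (fun x => p * (rmax x n)^(p-1))
        (fun x y hxy => by rw [rmax_congr hxy])
      refine le_trans ?_ h1
      rw [← sub_zero (∑ ω, μ ω * ((p-1) * (rmax (X ω) n)^p - _)), ← h2,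
        ← Finset.sum_sub_distrib]
      refine Finset.sum_le_sum fun ω _ => ?_
      rw [← mul_sub]
      refine mul_le_mul_of_nonneg_left ?_ (hμ ω)
      have hR := rmax_nonneg (hX ω) n
      simp only [rmax]
      rcases le_total (X ω (n+1)) (rmax (X ω) n) with h | h
      · rw [max_eq_left h]; linarith
      · rw [max_eq_right h]
        have e : (X ω (n+1))^p = (X ω (n+1))^(p-1) * X ω (n+1) := by
          rw [← Real.rpow_add_one' (hX ω _) (by linarith)]; congr 1; ring
        have := young_lem hp hR (hX ω (n+1))
        have e' : p * (X ω (n+1))^(p-1) * X ω (n+1) = p * (X ω (n+1))^p := by rw [e]; ring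
        rw [e']
        linarith
  have hN := key N le_rfl
  have hp1 : 0 < p - 1 := by linarith
  have : ∑ ω, μ ω * ((p-1)/2 * (rmax (X ω) N)^p - 2^(p-1) * (X ω N)^p) ≤ 0 := by
    refine le_trans (Finset.sum_le_sum fun ω _ => ?_) hN
    refine mul_le_mul_of_nonneg_left ?_ (hμ ω)
    have := young_scaled hp (l := 2) (by norm_num) (rmax_nonneg (hX ω) N) (hX ω N)
    linarith
  simp only [mul_sub, Finset.sum_sub_distrib] at this
  have e1 : ∑ ω, μ ω * ((p-1)/2 * (rmax (X ω) N)^p) =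
      (p-1)/2 * ∑ ω, μ ω * (rmax (X ω) N)^p := by
    rw [Finset.mul_sum]; exact Finset.sum_congr rfl fun _ _ => by ring
  have e2 : ∑ ω, μ ω * (2^(p-1) * (X ω N)^p) = 2^(p-1) * ∑ ω, μ ω * (X ω N)^p := by
    rw [Finset.mul_sum]; exact Finset.sum_congr rfl fun _ _ => by ring
  rw [e1, e2, Real.rpow_sub_one (by norm_num)] at this
  rw [div_mul_eq_mul_div, le_div_iff₀ hp1]
  linarith

lemma energy {p : ℝ} (hp : 1 < p) (hμ : ∀ ω, 0 ≤ μ ω) (hX : ∀ ω n, 0 ≤ X ω n)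
    (hM : Mart μ X N) (ε : ℝ) {n : ℕ} (hn : n ≤ N) (h : (ℕ → ℝ) → ℝ)
    (hh : ∀ x y : ℕ → ℝ, (∀ i ≤ n, x i = y i) → h x = h y) (hh0 : ∀ ω, 0 ≤ h (X ω)) :
    ∑ ω, μ ω * (h (X ω) * ∑ m ∈ Finset.Ico n N, ((samp ε (X ω) (m+1))^p - (samp ε (X ω) m)^p
      - p * (samp ε (X ω) m)^(p-1) * (samp ε (X ω) (m+1) - samp ε (X ω) m))) ≤
    ∑ ω, μ ω * (h (X ω) * ((X ω N)^p - ((samp ε (X ω) n)^p +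
      p * (samp ε (X ω) n)^(p-1) * (X ω n - samp ε (X ω) n)))) := by
  have key : ∀ l, n ≤ l → l ≤ N → 
    ∑ ω, μ ω * (h (X ω) * ∑ m ∈ Finset.Ico n l, ((samp ε (X ω) (m+1))^p - (samp ε (X ω) m)^p
      - p * (samp ε (X ω) m)^(p-1) * (samp ε (X ω) (m+1) - samp ε (X ω) m))) =
    ∑ ω, μ ω * (h (X ω) * (((samp ε (X ω) l)^p +
      p * (samp ε (X ω) l)^(p-1) * (X ω l - samp ε (X ω) l)) - ((samp ε (X ω) n)^p +
      p * (samp ε (X ω) n)^(p-1) * (X ω n - samp ε (X ω) n)))) := by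
    intro l hl
    induction l, hl using Nat.le_induction with
    | base => intro _; simp
    | succ l hl ih =>
      intro hlN
      have h1 := ih (by omega)
      have h2 := hM l (by omega) (fun x => h x * (p * (samp ε x l)^(p-1)))
        (fun x y hxy => by
          rw [samp_congr ε hxy, hh x y (fun i hi => hxy i (by omega))])
      rw [← sub_eq_zero] at h1 ⊢
      rw [← Finset.sum_sub_distrib] at h1 ⊢
      have h12 := congrArg₂ (· - ·) h1 h2
      simp only [sub_zero] at h12
      rw [← h12, ← Finset.sum_sub_distrib]
      refine Finset.sum_congr rfl fun ω _ => ?_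
      rw [Finset.sum_Ico_succ_top hl]
      by_cases hj : samp ε (X ω) (l+1) = samp ε (X ω) l
      · rw [hj]; ring
      · rw [(samp_jump hj).1]; ring
  rw [key N hn le_rfl]
  refine Finset.sum_le_sum fun ω _ => mul_le_mul_of_nonneg_left
    (mul_le_mul_of_nonneg_left ?_ (hh0 ω)) (hμ ω)
  have := breg_nonneg hp (samp_nonneg (ε := ε) (hX ω) N) (hX ω N)
  linarith

end mart
end VG

namespace VG

noncomputable def geo (r : ℝ) : ℝ := (1 - (1/2:ℝ)^(r-2))⁻¹

lemma half_rpow_lt {r : ℝ} (hr : 2 < r) : (1/2:ℝ)^(r-2) < 1 :=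
  Real.rpow_lt_one (by norm_num) (by norm_num) (by linarith)

lemma geo_pos {r : ℝ} (hr : 2 < r) : 0 < geo r :=
  inv_pos.2 (by linarith [half_rpow_lt hr])

lemma geo_sum {r : ℝ} (hr : 2 < r) (K : ℕ) :
    ∑ k ∈ Finset.range K, ((1/2:ℝ)^k)^(r-2) ≤ geo r := by
  have e : ∀ k : ℕ, ((1/2:ℝ)^k)^(r-2) = ((1/2:ℝ)^(r-2))^k := by
    intro k
    rw [← Real.rpow_natCast, ← Real.rpow_mul (by norm_num), mul_comm, Real.rpow_mul (by norm_num),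
      Real.rpow_natCast]
  simp only [e]
  have h0 : 0 ≤ (1/2:ℝ)^(r-2) := by positivity
  rw [geo, ← tsum_geometric_of_lt_one h0 (half_rpow_lt hr)]
  exact (summable_geometric_of_lt_one h0 (half_rpow_lt hr)).sum_le_tsum _
    (fun k _ => by positivity)

lemma interp_le {Z Y θ : ℝ} (hZ : 0 ≤ Z) (hY : 0 ≤ Y) (h0 : 0 < θ) (h1 : θ < 1) :
    Z^(1-θ) * Y^θ ≤ Z + Y := by
  have hT : 0 ≤ Z + Y := by linarith
  calc Z^(1-θ) * Y^θ ≤ (Z+Y)^(1-θ) * (Z+Y)^θ := by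
        gcongr <;> linarith
    _ = Z + Y := by rw [← Real.rpow_add' hT (by norm_num)]; norm_num

lemma rpow_add_le_crude {x y s : ℝ} (hx : 0 ≤ x) (hy : 0 ≤ y) (hs : 0 < s) :
    (x + y)^s ≤ 2^s * (x^s + y^s) := by
  have hm : x + y ≤ 2 * max x y := by
    have := le_max_left x y; have := le_max_right x y; linarith
  calc (x+y)^s ≤ (2 * max x y)^s := Real.rpow_le_rpow (by linarith) hm hs.le
    _ = 2^s * (max x y)^s := Real.mul_rpow (by norm_num) (le_max_of_le_left hx)
    _ ≤ _ := by
      refine mul_le_mul_of_nonneg_left ?_ (by positivity)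
      have := Real.rpow_nonneg hx s
      have := Real.rpow_nonneg hy s
      rcases max_cases x y with h | h <;> rw [h.1] <;> linarith

lemma samp_diff_sq {ε : ℝ} {x : ℕ → ℝ} (hx : ∀ n, 0 ≤ x n) {m N : ℕ} (h : m < N) :
    (samp ε x (m+1) - samp ε x m)^2 ≤ (rmax x N)^2 := by
  have h1 := samp_nonneg (ε := ε) hx m
  have h2 := samp_nonneg (ε := ε) hx (m+1)
  have h3 := (samp_le (ε := ε) (x := x) m).trans (rmax_mono x h.le)
  have h4 := (samp_le (ε := ε) (x := x) (m+1)).trans (rmax_mono x h)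
  exact sq_le_sq' (by linarith) (by linarith)

lemma wsq_congr (r : ℝ) (K : ℕ) {x y : ℕ → ℝ} {n : ℕ} (h : ∀ i ≤ n, x i = y i) :
    wsq r K x n = wsq r K y n := by
  simp only [wsq]
  refine Finset.sum_congr rfl fun k _ => ?_
  congr 1
  refine Finset.sum_congr rfl fun m hm => ?_
  rw [Finset.mem_range] at hm
  rw [samp_congr _ (n := m) (fun i hi => h i (by omega)),
    samp_congr _ (n := m+1) (fun i hi => h i (by omega))]

section mart
variable {Ω : Type} [Fintype Ω] {μ : Ω → ℝ} {X : Ω → ℕ → ℝ} {N : ℕ}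

lemma wsq_low {p r : ℝ} (hp : 1 < p) (hp2 : p ≤ 2) (hr : 2 < r) (K : ℕ)
    (hμ : ∀ ω, 0 ≤ μ ω) (hX : ∀ ω n, 0 ≤ X ω n) (hM : Mart μ X N) :
    ∑ ω, μ ω * (wsq r K (X ω) N * (rmax (X ω) N)^(p-2)) ≤
      geo r * (2/(p*(p-1))) * ∑ ω, μ ω * (X ω N)^p := by
  have hc : 0 < p*(p-1)/2 := by nlinarith
  have one : ∀ ε : ℝ, ∑ ω, μ ω * ((∑ m ∈ Finset.range N, (samp ε (X ω) (m+1) - samp ε (X ω) m)^2)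
      * (rmax (X ω) N)^(p-2)) ≤ 2/(p*(p-1)) * ∑ ω, μ ω * (X ω N)^p := by
    intro ε
    have h := energy hp hμ hX hM ε (Nat.zero_le N) (fun _ => 1) (fun _ _ _ => rfl)
      (fun _ => zero_le_one)
    have h2 : p*(p-1)/2 * ∑ ω, μ ω * ((∑ m ∈ Finset.range N,
        (samp ε (X ω) (m+1) - samp ε (X ω) m)^2) * (rmax (X ω) N)^(p-2)) ≤
        ∑ ω, μ ω * (X ω N)^p := by
      refine le_trans ?_ (h.trans ?_)
      · rw [Finset.mul_sum]
        refine Finset.sum_le_sum fun ω _ => ?_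
        rw [mul_left_comm]
        refine mul_le_mul_of_nonneg_left ?_ (hμ ω)
        rw [one_mul, Finset.sum_mul, Finset.mul_sum, Finset.range_eq_Ico]
        refine Finset.sum_le_sum fun m hm => ?_
        rw [Finset.mem_Ico] at hm
        exact breg_low hp hp2 (samp_nonneg (hX ω) _)
          ((samp_le _).trans (rmax_mono _ (by omega))) (samp_nonneg (hX ω) _)
          ((samp_le _).trans (rmax_mono _ (by omega)))
      · refine Finset.sum_le_sum fun ω _ => mul_le_mul_of_nonneg_left ?_ (hμ ω)
        have := Real.rpow_nonneg (hX ω 0) p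
        simp only [samp, sub_self, mul_zero, add_zero, one_mul]; linarith
    have e : 2/(p*(p-1)) = (p*(p-1)/2)⁻¹ := by rw [inv_div]
    rw [e, inv_mul_eq_div, le_div_iff₀ hc, mul_comm]
    exact h2
  have hI : 0 ≤ ∑ ω, μ ω * (X ω N)^p :=
    Finset.sum_nonneg fun ω _ => mul_nonneg (hμ ω) (Real.rpow_nonneg (hX ω N) _)
  calc _ = ∑ k ∈ Finset.range K, ((1/2:ℝ)^k)^(r-2) * ∑ ω, μ ω * ((∑ m ∈ Finset.range N,
        (samp ((1/2:ℝ)^k) (X ω) (m+1) - samp ((1/2:ℝ)^k) (X ω) m)^2) * (rmax (X ω) N)^(p-2)) := by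
        simp only [wsq, Finset.mul_sum, Finset.sum_mul]
        rw [Finset.sum_comm]
        refine Finset.sum_congr rfl fun k _ => Finset.sum_congr rfl fun ω _ =>
          Finset.sum_congr rfl fun m _ => by ring
    _ ≤ ∑ k ∈ Finset.range K, ((1/2:ℝ)^k)^(r-2) * (2/(p*(p-1)) * ∑ ω, μ ω * (X ω N)^p) :=
        Finset.sum_le_sum fun k _ => mul_le_mul_of_nonneg_left (one _) (by positivity)
    _ ≤ geo r * (2/(p*(p-1)) * ∑ ω, μ ω * (X ω N)^p) := by
        rw [← Finset.sum_mul]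
        refine mul_le_mul_of_nonneg_right (geo_sum hr K) (mul_nonneg ?_ hI)
        exact div_nonneg (by norm_num) (by nlinarith)
    _ = _ := by ring

lemma cond_sq (hμ : ∀ ω, 0 ≤ μ ω) (hX : ∀ ω n, 0 ≤ X ω n) (hM : Mart μ X N) (ε : ℝ)
    {n : ℕ} (hn : n < N) (h : (ℕ → ℝ) → ℝ)
    (hh : ∀ x y : ℕ → ℝ, (∀ i ≤ n+1, x i = y i) → h x = h y) (hh0 : ∀ ω, 0 ≤ h (X ω)) :
    ∑ ω, μ ω * (h (X ω) * ∑ m ∈ Finset.Ico n N, (samp ε (X ω) (m+1) - samp ε (X ω) m)^2) ≤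
    3 * ∑ ω, μ ω * (h (X ω) * (rmax (X ω) N)^2) := by
  have hE := energy (p := 2) (by norm_num) hμ hX hM ε (n := n+1) hn h hh hh0
  have e1 : (2:ℝ) - 1 = 1 := by norm_num
  simp only [Real.rpow_two, e1, Real.rpow_one] at hE
  have e : ∀ ω, ∑ m ∈ Finset.Ico (n+1) N, ((samp ε (X ω) (m+1))^2 - (samp ε (X ω) m)^2
      - 2 * (samp ε (X ω) m) * (samp ε (X ω) (m+1) - samp ε (X ω) m)) =
      ∑ m ∈ Finset.Ico (n+1) N, (samp ε (X ω) (m+1) - samp ε (X ω) m)^2 := fun ω =>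
    Finset.sum_congr rfl fun m _ => by ring
  simp only [e] at hE
  have h2 : ∑ ω, μ ω * (h (X ω) * ((X ω N)^2 - ((samp ε (X ω) (n+1))^2 +
      2 * (samp ε (X ω) (n+1)) * (X ω (n+1) - samp ε (X ω) (n+1))))) ≤
      ∑ ω, μ ω * (h (X ω) * (2 * (rmax (X ω) N)^2)) := by
    refine Finset.sum_le_sum fun ω _ => mul_le_mul_of_nonneg_left
      (mul_le_mul_of_nonneg_left ?_ (hh0 ω)) (hμ ω)
    have a1 := samp_nonneg (ε := ε) (hX ω) (n+1)
    have a2 := (samp_le (ε := ε) (x := X ω) (n+1)).trans (rmax_mono (X ω) hn)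
    have a3 := le_rmax_self (X ω) N
    have a4 := hX ω N
    have a5 := hX ω (n+1)
    have : 0 ≤ samp ε (X ω) (n+1) * X ω (n+1) := mul_nonneg a1 a5
    nlinarith
  have h3 : ∑ ω, μ ω * (h (X ω) * (samp ε (X ω) (n+1) - samp ε (X ω) n)^2) ≤
      ∑ ω, μ ω * (h (X ω) * (rmax (X ω) N)^2) :=
    Finset.sum_le_sum fun ω _ => mul_le_mul_of_nonneg_left
      (mul_le_mul_of_nonneg_left (samp_diff_sq (hX ω) hn) (hh0 ω)) (hμ ω)
  have h4 : ∑ ω, μ ω * (h (X ω) * (2 * (rmax (X ω) N)^2)) =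
      2 * ∑ ω, μ ω * (h (X ω) * (rmax (X ω) N)^2) := by
    rw [Finset.mul_sum]; exact Finset.sum_congr rfl fun _ _ => by ring
  have h5 : ∑ ω, μ ω * (h (X ω) * ∑ m ∈ Finset.Ico n N,
      (samp ε (X ω) (m+1) - samp ε (X ω) m)^2) =
      ∑ ω, μ ω * (h (X ω) * (samp ε (X ω) (n+1) - samp ε (X ω) n)^2) +
      ∑ ω, μ ω * (h (X ω) * ∑ m ∈ Finset.Ico (n+1) N,
        (samp ε (X ω) (m+1) - samp ε (X ω) m)^2) := by
    rw [← Finset.sum_add_distrib]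
    refine Finset.sum_congr rfl fun ω _ => ?_
    rw [Finset.sum_eq_sum_Ico_succ_bot hn]; ring
  linarith

lemma cond_wsq {r : ℝ} (hr : 2 < r) (K : ℕ)
    (hμ : ∀ ω, 0 ≤ μ ω) (hX : ∀ ω n, 0 ≤ X ω n) (hM : Mart μ X N)
    {n : ℕ} (hn : n < N) (h : (ℕ → ℝ) → ℝ)
    (hh : ∀ x y : ℕ → ℝ, (∀ i ≤ n+1, x i = y i) → h x = h y) (hh0 : ∀ ω, 0 ≤ h (X ω)) :
    ∑ ω, μ ω * (h (X ω) * (wsq r K (X ω) N - wsq r K (X ω) n)) ≤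
    3 * geo r * ∑ ω, μ ω * (h (X ω) * (rmax (X ω) N)^2) := by
  have hI : 0 ≤ ∑ ω, μ ω * (h (X ω) * (rmax (X ω) N)^2) :=
    Finset.sum_nonneg fun ω _ => mul_nonneg (hμ ω) (mul_nonneg (hh0 ω) (sq_nonneg _))
  calc _ = ∑ k ∈ Finset.range K, ((1/2:ℝ)^k)^(r-2) * ∑ ω, μ ω * (h (X ω) *
        ∑ m ∈ Finset.Ico n N,
        (samp ((1/2:ℝ)^k) (X ω) (m+1) - samp ((1/2:ℝ)^k) (X ω) m)^2) := by
        simp only [wsq_sub r K _ hn.le, Finset.mul_sum]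
        rw [Finset.sum_comm]
        refine Finset.sum_congr rfl fun k _ => Finset.sum_congr rfl fun ω _ =>
          Finset.sum_congr rfl fun m _ => by ring
    _ ≤ ∑ k ∈ Finset.range K, ((1/2:ℝ)^k)^(r-2) *
        (3 * ∑ ω, μ ω * (h (X ω) * (rmax (X ω) N)^2)) :=
        Finset.sum_le_sum fun k _ => mul_le_mul_of_nonneg_left
          (cond_sq hμ hX hM _ hn h hh hh0) (by positivity)
    _ ≤ geo r * (3 * ∑ ω, μ ω * (h (X ω) * (rmax (X ω) N)^2)) := by
        rw [← Finset.sum_mul]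
        exact mul_le_mul_of_nonneg_right (geo_sum hr K) (by linarith)
    _ = _ := by ring

lemma garsia {r s : ℝ} (hs : 1 < s) (hr : 2 < r) (K : ℕ)
    (hμ : ∀ ω, 0 ≤ μ ω) (hX : ∀ ω n, 0 ≤ X ω n) (hM : Mart μ X N) :
    ∑ ω, μ ω * (wsq r K (X ω) N)^s ≤
      2 * ((2*s)^(s-1) * (3 * geo r)^s) * ∑ ω, μ ω * ((rmax (X ω) N)^2)^s := by
  have hg := geo_pos hr
  set d : ℕ → (ℕ → ℝ) → ℝ := fun n x => (wsq r K x (n+1))^(s-1) - (wsq r K x n)^(s-1) with hd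
  have hd0 : ∀ n x, 0 ≤ d n x := fun n x => sub_nonneg.2 <|
    Real.rpow_le_rpow (wsq_nonneg _ _ _ _) (wsq_mono r K x (Nat.le_succ n)) (by linarith)
  -- pathwise
  have path : ∀ x : ℕ → ℝ, (wsq r K x N)^s ≤
      s * ∑ n ∈ Finset.range N, d n x * (wsq r K x N - wsq r K x n) := by
    intro x
    have key : ∀ n, (wsq r K x n)^s + s * (wsq r K x N - wsq r K x n) * (wsq r K x n)^(s-1)
        ≤ s * ∑ n ∈ Finset.range n, d n x * (wsq r K x N - wsq r K x n) := by
      intro n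
      induction n with
      | zero => simp [wsq_zero, Real.zero_rpow (by linarith : s ≠ 0),
          Real.zero_rpow (by linarith : s - 1 ≠ 0)]
      | succ n ih =>
        rw [Finset.sum_range_succ]
        have hb := breg_nonneg hs (wsq_nonneg r K x (n+1)) (wsq_nonneg r K x n)
        simp only [hd] at ih ⊢
        nlinarith
    simpa using key N
  set I := ∑ ω, μ ω * (wsq r K (X ω) N)^s
  have h1 : I ≤ ∑ ω, μ ω * (s * (wsq r K (X ω) N)^(s-1) * (3 * geo r * (rmax (X ω) N)^2)) := by
    calc I ≤ ∑ ω, μ ω * (s * ∑ n ∈ Finset.range N, d n (X ω) *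
          (wsq r K (X ω) N - wsq r K (X ω) n)) :=
          Finset.sum_le_sum fun ω _ => mul_le_mul_of_nonneg_left (path _) (hμ ω)
      _ = s * ∑ n ∈ Finset.range N, ∑ ω, μ ω * (d n (X ω) *
          (wsq r K (X ω) N - wsq r K (X ω) n)) := by
          rw [Finset.sum_comm]
          simp only [Finset.mul_sum]
          exact Finset.sum_congr rfl fun ω _ => Finset.sum_congr rfl fun n _ => by ring
      _ ≤ s * ∑ n ∈ Finset.range N, 3 * geo r * ∑ ω, μ ω * (d n (X ω) * (rmax (X ω) N)^2) := by
          refine mul_le_mul_of_nonneg_left (Finset.sum_le_sum fun n hn => ?_) (by linarith)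
          refine cond_wsq hr K hμ hX hM (Finset.mem_range.1 hn) (d n) (fun x y hxy => ?_)
            (fun ω => hd0 n _)
          simp only [hd]
          rw [wsq_congr r K hxy, wsq_congr r K (n := n) (fun i hi => hxy i (by omega))]
      _ = ∑ ω, μ ω * (s * (∑ n ∈ Finset.range N, d n (X ω)) *
          (3 * geo r * (rmax (X ω) N)^2)) := by
          simp only [Finset.mul_sum, Finset.sum_mul]
          rw [Finset.sum_comm]
          exact Finset.sum_congr rfl fun ω _ => Finset.sum_congr rfl fun n _ => by ring
      _ = _ := by
          refine Finset.sum_congr rfl fun ω _ => ?_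
          simp only [hd]
          rw [Finset.sum_range_sub (fun n => (wsq r K (X ω) n)^(s-1)), wsq_zero,
            Real.zero_rpow (by linarith : s - 1 ≠ 0), sub_zero]
  have h2 : ∑ ω, μ ω * (s * (wsq r K (X ω) N)^(s-1) * (3 * geo r * (rmax (X ω) N)^2)) ≤
      ∑ ω, μ ω * (1/2 * (wsq r K (X ω) N)^s +
        ((2*s)^(s-1) * (3 * geo r)^s) * ((rmax (X ω) N)^2)^s) := by
    refine Finset.sum_le_sum fun ω _ => mul_le_mul_of_nonneg_left ?_ (hμ ω)
    have hy := young_scaled hs (l := 2*s) (by linarith) (wsq_nonneg r K (X ω) N)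
      (show 0 ≤ 3 * geo r * (rmax (X ω) N)^2 by positivity)
    rw [Real.mul_rpow (x := 3 * geo r) (by positivity) (by positivity)] at hy
    have h3 : (s-1)/(2*s) ≤ 1/2 := by
      rw [div_le_div_iff₀ (by linarith) (by norm_num)]; linarith
    have h4 : (s-1)/(2*s) * (wsq r K (X ω) N)^s ≤ 1/2 * (wsq r K (X ω) N)^s :=
      mul_le_mul_of_nonneg_right h3 (Real.rpow_nonneg (wsq_nonneg _ _ _ _) _)
    linarith
  have h3 : ∑ ω, μ ω * (1/2 * (wsq r K (X ω) N)^s +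
        ((2*s)^(s-1) * (3 * geo r)^s) * ((rmax (X ω) N)^2)^s) = 1/2 * I +
      ((2*s)^(s-1) * (3 * geo r)^s) * ∑ ω, μ ω * ((rmax (X ω) N)^2)^s := by
    simp only [mul_add, Finset.sum_add_distrib, Finset.mul_sum, I]
    congr 1 <;> exact Finset.sum_congr rfl fun _ _ => by ring
  linarith

end mart

lemma wsq_moment {p r : ℝ} (hp : 1 < p) (hr : 2 < r) : ∃ C : ℝ, 0 < C ∧
    ∀ (Ω : Type) [Fintype Ω] (μ : Ω → ℝ) (X : Ω → ℕ → ℝ) (N K : ℕ), (∀ ω, 0 ≤ μ ω) →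
    (∀ ω n, 0 ≤ X ω n) → Mart μ X N →
    ∑ ω, μ ω * ((rmax (X ω) N)^(r-2) * wsq r K (X ω) N)^(p/r) ≤
      C * ∑ ω, μ ω * (X ω N)^p := by
  have hg := geo_pos hr
  have hD : 0 < 2^p/(p-1) := div_pos (by positivity) (by linarith)
  have hr0 : 0 < r := by linarith
  rcases le_or_gt p 2 with hp2 | hp2
  · refine ⟨2^p/(p-1) + geo r * (2/(p*(p-1))), ?_, ?_⟩
    · have : 0 < 2/(p*(p-1)) := div_pos (by norm_num) (by nlinarith)
      positivity
    intro Ω _ μ X N K hμ hX hM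
    have h1 := doob hp hμ hX hM
    have h2 := wsq_low hp hp2 hr K hμ hX hM
    refine le_trans (Finset.sum_le_sum fun ω _ => ?_) ((Finset.sum_add_distrib
      (f := fun ω => μ ω * (rmax (X ω) N)^p)
      (g := fun ω => μ ω * (wsq r K (X ω) N * (rmax (X ω) N)^(p-2)))).le.trans (by linarith))
    rw [← mul_add]
    refine mul_le_mul_of_nonneg_left ?_ (hμ ω)
    have hW := wsq_nonneg r K (X ω) N
    rcases (rmax_nonneg (hX ω) N).eq_or_lt with h0 | hR
    · rw [← h0, Real.zero_rpow (by linarith), zero_mul, Real.zero_rpow (by positivity)]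
      positivity
    · have e : (rmax (X ω) N)^(r-2) * wsq r K (X ω) N =
          (rmax (X ω) N)^(r-p) * (wsq r K (X ω) N * (rmax (X ω) N)^(p-2)) := by
        rw [mul_left_comm, ← Real.rpow_add hR, mul_comm]; congr 2; ring
      have e2 : ((rmax (X ω) N)^(r-p))^(p/r) = ((rmax (X ω) N)^p)^(1-p/r) := by
        rw [← Real.rpow_mul hR.le, ← Real.rpow_mul hR.le]; congr 1; field_simp
      rw [e, Real.mul_rpow (by positivity) (by positivity), e2]
      exact interp_le (by positivity) (by positivity) (by positivity)
        ((div_lt_one hr0).2 (by linarith))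
  · set c := 2 * ((2*(p/2))^(p/2-1) * (3 * geo r)^(p/2)) with hc
    have hc0 : 0 < c := by positivity
    refine ⟨(1 + c) * (2^p/(p-1)), by positivity, ?_⟩
    intro Ω _ μ X N K hμ hX hM
    have h1 := doob hp hμ hX hM
    have h2 := garsia (s := p/2) (by linarith) hr K hμ hX hM
    rw [← hc] at h2
    have e3 : ∑ ω, μ ω * ((rmax (X ω) N)^2)^(p/2) = ∑ ω, μ ω * (rmax (X ω) N)^p := by
      refine Finset.sum_congr rfl fun ω _ => ?_
      rw [← Real.rpow_natCast, ← Real.rpow_mul (rmax_nonneg (hX ω) N)]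
      congr 2; push_cast; ring
    rw [e3] at h2
    have h3 : c * ∑ ω, μ ω * (rmax (X ω) N)^p ≤ c * (2^p/(p-1) * ∑ ω, μ ω * (X ω N)^p) := by
      gcongr
    refine le_trans (Finset.sum_le_sum fun ω _ => ?_) ((Finset.sum_add_distrib
      (f := fun ω => μ ω * (rmax (X ω) N)^p)
      (g := fun ω => μ ω * (wsq r K (X ω) N)^(p/2))).le.trans (by linarith))
    rw [← mul_add]
    refine mul_le_mul_of_nonneg_left ?_ (hμ ω)
    have hW := wsq_nonneg r K (X ω) N
    have hR := rmax_nonneg (hX ω) N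
    rw [Real.mul_rpow (by positivity) hW]
    have e1 : ((rmax (X ω) N)^(r-2))^(p/r) = ((rmax (X ω) N)^p)^(1-2/r) := by
      rw [← Real.rpow_mul hR, ← Real.rpow_mul hR]; congr 1; field_simp
    have e2 : (wsq r K (X ω) N)^(p/r) = ((wsq r K (X ω) N)^(p/2))^(2/r) := by
      rw [← Real.rpow_mul hW]; congr 1; field_simp
    rw [e1, e2]
    exact interp_le (by positivity) (by positivity) (by positivity)
        ((div_lt_one hr0).2 (by linarith))

theorem lepingle {p r : ℝ} (hp : 1 < p) (hr : 2 < r) : ∃ C : ℝ, 0 < C ∧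
    ∀ (Ω : Type) [Fintype Ω] (μ : Ω → ℝ) (X : Ω → ℕ → ℝ) (N : ℕ), (∀ ω, 0 ≤ μ ω) →
    (∀ ω n, 0 ≤ X ω n) → Mart μ X N →
    ∃ B : Ω → ℝ, (∀ ω, 0 ≤ B ω) ∧ (∀ ω J (u : Fin (J+1) → ℕ), StrictMono u → (∀ j, u j ≤ N) →
      ∑ j : Fin J, |X ω (u j.succ) - X ω (u j.castSucc)|^r ≤ B ω ^ r) ∧
      ∑ ω, μ ω * B ω ^ p ≤ C * ∑ ω, μ ω * (X ω N)^p := by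
  obtain ⟨C, hC, hW⟩ := wsq_moment hp hr
  have hr0 : 0 < r := by linarith
  have hD : 0 < 2^p/(p-1) := div_pos (by positivity) (by linarith)
  refine ⟨2^(p/r) * (2^(p/r) * (2^p/(p-1)) + (256 * 8^(r-2))^(p/r) * C), by positivity, ?_⟩
  intro Ω _ μ X N hμ hX hM
  have hev : ∀ᶠ K in Filter.atTop, ∀ ω, ∀ J (u : Fin (J+1) → ℕ), StrictMono u → (∀ j, u j ≤ N) →
      ∑ j : Fin J, |X ω (u j.succ) - X ω (u j.castSucc)|^r ≤ pot r K N (X ω) N := by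
    rw [Filter.eventually_all]
    exact fun ω => pathwise hr (hX ω) N
  obtain ⟨K, hK⟩ := hev.exists
  have hpot : ∀ ω, 0 ≤ pot r K N (X ω) N := fun ω => by
    have := rmax_nonneg (hX ω) N
    have := wsq_nonneg r K (X ω) N
    simp only [pot]; positivity
  refine ⟨fun ω => (pot r K N (X ω) N)^(1/r), fun ω => Real.rpow_nonneg (hpot ω) _, ?_, ?_⟩
  · intro ω J u hu huN
    rw [← Real.rpow_mul (hpot ω), one_div_mul_cancel hr0.ne', Real.rpow_one]
    exact hK ω J u hu huN
  · have h1 := doob hp hμ hX hM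
    have h2 := hW Ω μ X N K hμ hX hM
    have hpt : ∀ ω, ((pot r K N (X ω) N)^(1/r))^p ≤ 2^(p/r) * (2^(p/r) * (rmax (X ω) N)^p +
        (256 * 8^(r-2))^(p/r) * ((rmax (X ω) N)^(r-2) * wsq r K (X ω) N)^(p/r)) := by
      intro ω
      have hR := rmax_nonneg (hX ω) N
      have hWn := wsq_nonneg r K (X ω) N
      rw [← Real.rpow_mul (hpot ω), one_div_mul_eq_div]
      have e1 : (2:ℝ)^(p/r) * (rmax (X ω) N)^p = (2 * (rmax (X ω) N)^r)^(p/r) := by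
        rw [Real.mul_rpow (by norm_num) (by positivity), ← Real.rpow_mul hR]
        congr 2; field_simp
      rw [e1, ← Real.mul_rpow (by positivity) (by positivity)]
      refine le_trans (le_of_eq ?_) (rpow_add_le_crude (by positivity) (by positivity)
        (by positivity))
      simp only [pot]; congr 1; ring
    calc _ ≤ ∑ ω, μ ω * (2^(p/r) * (2^(p/r) * (rmax (X ω) N)^p +
        (256 * 8^(r-2))^(p/r) * ((rmax (X ω) N)^(r-2) * wsq r K (X ω) N)^(p/r))) :=
          Finset.sum_le_sum fun ω _ => mul_le_mul_of_nonneg_left (hpt ω) (hμ ω)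
      _ = 2^(p/r) * (2^(p/r) * ∑ ω, μ ω * (rmax (X ω) N)^p +
        (256 * 8^(r-2))^(p/r) * ∑ ω, μ ω * ((rmax (X ω) N)^(r-2) * wsq r K (X ω) N)^(p/r)) := by
          simp only [Finset.mul_sum, ← Finset.sum_add_distrib]
          exact Finset.sum_congr rfl fun _ _ => by ring
      _ ≤ 2^(p/r) * (2^(p/r) * (2^p/(p-1) * ∑ ω, μ ω * (X ω N)^p) +
        (256 * 8^(r-2))^(p/r) * (C * ∑ ω, μ ω * (X ω N)^p)) := by gcongr
      _ = _ := by ring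

end VG

namespace VG

lemma minkowski {ι : Type*} [Fintype ι] {J : ℕ} {r : ℝ} (hr : 1 ≤ r) (w : ι → ℝ) (hw : ∀ i, 0 ≤ w i)
    (a : ι → Fin J → ℝ) (b : ι → ℝ) (hb : ∀ i, 0 ≤ b i)
    (h : ∀ i, ∑ j, |a i j|^r ≤ b i ^ r) :
    ∑ j, |∑ i, w i * a i j|^r ≤ (∑ i, w i * b i)^r := by
  have hr0 : 0 < r := by linarith
  have hP : (ENNReal.ofReal r).toReal = r := ENNReal.toReal_ofReal hr0.le
  haveI : Fact (1 ≤ ENNReal.ofReal r) := ⟨by simpa using ENNReal.ofReal_le_ofReal hr⟩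
  let v : ι → PiLp (ENNReal.ofReal r) (fun _ : Fin J => ℝ) := fun i => WithLp.toLp _ (a i)
  have hn : ∀ x : PiLp (ENNReal.ofReal r) (fun _ : Fin J => ℝ),
      ‖x‖ = (∑ j, |x j|^r)^(1/r) := by
    intro x
    rw [PiLp.norm_eq_sum (by rw [hP]; exact hr0), hP]; rfl
  have h1 : ‖∑ i, w i • v i‖ ≤ ∑ i, w i * b i := by
    refine (norm_sum_le _ _).trans (Finset.sum_le_sum fun i _ => ?_)
    rw [norm_smul, Real.norm_of_nonneg (hw i)]
    refine mul_le_mul_of_nonneg_left ?_ (hw i)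
    rw [hn]
    calc _ ≤ (b i ^ r)^(1/r) := Real.rpow_le_rpow
          (Finset.sum_nonneg fun j _ => by positivity) (h i) (by positivity)
      _ = b i := by rw [← Real.rpow_mul (hb i), mul_one_div_cancel hr0.ne', Real.rpow_one]
  rw [hn] at h1
  have hpos : 0 ≤ ∑ j, |(∑ i, w i • v i) j|^r := Finset.sum_nonneg fun j _ => by positivity
  have h2 := Real.rpow_le_rpow (by positivity) h1 hr0.le
  rw [← Real.rpow_mul hpos, one_div_mul_cancel hr0.ne', Real.rpow_one] at h2
  refine le_trans (le_of_eq ?_) h2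
  refine Finset.sum_congr rfl fun j _ => ?_
  congr 2
  simp [v]

lemma jensen {ι : Type*} [Fintype ι] {p : ℝ} (hp : 1 ≤ p) (w b : ι → ℝ) (hw : ∀ i, 0 ≤ w i)
    (hw1 : ∑ i, w i = 1) (hb : ∀ i, 0 ≤ b i) :
    (∑ i, w i * b i)^p ≤ ∑ i, w i * b i ^ p :=
  Real.rpow_arith_mean_le_arith_mean_rpow _ _ _ (fun i _ => hw i) hw1 (fun i _ => hb i) hp

section grp
variable {S : Type} [Fintype S] [AddCommGroup S] {N : ℕ}

def ps (ξ : Fin N → S) (k : ℕ) : S := ∑ l : Fin N, if (l:ℕ) < k then ξ l else 0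

lemma ps_update_lt (ξ : Fin N → S) (i : Fin N) (s : S) {k : ℕ} (h : (i:ℕ) < k) :
    ps (Function.update ξ i s) k = ps ξ k - ξ i + s := by
  have : ps (Function.update ξ i s) k - ps ξ k = s - ξ i := by
    simp only [ps, ← Finset.sum_sub_distrib]
    rw [Finset.sum_eq_single i]
    · simp [h]
    · intro b _ hb; simp [Function.update_of_ne hb]
    · simp
  rw [← sub_eq_zero] at this ⊢
  rw [← this]; abel

lemma ps_update_ge (ξ : Fin N → S) (i : Fin N) (s : S) {k : ℕ} (h : k ≤ i) :
    ps (Function.update ξ i s) k = ps ξ k := by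
  refine Finset.sum_congr rfl fun l _ => ?_
  split_ifs with hl
  · rw [Function.update_of_ne]; rintro rfl; omega
  · rfl

lemma ps_succ (ξ : Fin N → S) (i : Fin N) : ps ξ (i+1) = ps ξ i + ξ i := by
  have : ps ξ (i+1) - ps ξ i = ξ i := by
    simp only [ps, ← Finset.sum_sub_distrib]
    rw [Finset.sum_eq_single i]
    · simp
    · intro b _ hb
      have : (b:ℕ) ≠ i := fun h => hb (Fin.ext h)
      by_cases hbi : (b:ℕ) < i
      · rw [if_pos (by omega), if_pos hbi, sub_self]
      · rw [if_neg (by omega), if_neg hbi, sub_self]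
    · simp
  rw [← this]; abel

def pw (ν : ℕ → S → ℝ) (ξ : Fin N → S) : ℝ := ∏ k : Fin N, ν k (ξ k)

lemma pw_update (ν : ℕ → S → ℝ) (ξ : Fin N → S) (i : Fin N) (s : S) :
    pw ν (Function.update ξ i s) * ν i (ξ i) = pw ν ξ * ν i s := by
  simp only [pw]
  rw [← Finset.mul_prod_erase _ _ (Finset.mem_univ i),
    ← Finset.mul_prod_erase _ (fun k : Fin N => ν k (ξ k)) (Finset.mem_univ i)]
  have : ∏ x ∈ Finset.univ.erase i, ν x (Function.update ξ i s x) =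
      ∏ x ∈ Finset.univ.erase i, ν x (ξ x) :=
    Finset.prod_congr rfl fun x hx => by rw [Function.update_of_ne (Finset.ne_of_mem_erase hx)]
  rw [this, Function.update_self]; ring

lemma resample (ν : ℕ → S → ℝ) (hν1 : ∀ i, ∑ s, ν i s = 1) (i : Fin N)
    (G : (Fin N → S) → ℝ) :
    ∑ ξ, pw ν ξ * ∑ s, ν i s * G (Function.update ξ i s) = ∑ ξ, pw ν ξ * G ξ := by
  let e : (Fin N → S) × S → (Fin N → S) × S := fun q => (Function.update q.1 i q.2, q.1 i)
  have he : Function.Involutive e := by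
    rintro ⟨ξ, s⟩; simp [e]
  have h := (Equiv.sum_comp he.toPerm
    (fun q : (Fin N → S) × S => pw ν q.1 * ν i q.2 * G q.1))
  simp only [Fintype.sum_prod_type, Function.Involutive.coe_toPerm, e] at h
  calc _ = ∑ ξ, ∑ s, pw ν (Function.update ξ i s) * ν i (ξ i) * G (Function.update ξ i s) := by
        refine Finset.sum_congr rfl fun ξ _ => ?_
        rw [Finset.mul_sum]
        refine Finset.sum_congr rfl fun s _ => ?_
        rw [pw_update]; ring
    _ = _ := h
    _ = _ := by
        refine Finset.sum_congr rfl fun ξ _ => ?_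
        rw [← Finset.sum_mul, ← Finset.mul_sum, hν1, mul_one]

lemma resample2 (ν : ℕ → S → ℝ) (hν1 : ∀ i, ∑ s, ν i s = 1) (i : Fin N)
    (G : S × (Fin N → S) → ℝ) :
    ∑ ω : S × (Fin N → S), pw ν ω.2 * ∑ s, ν i s *
      G (ω.1 + ω.2 i - s, Function.update ω.2 i s) =
    ∑ ω : S × (Fin N → S), pw ν ω.2 * G ω := by
  rw [Fintype.sum_prod_type_right, Fintype.sum_prod_type_right]
  have h := resample ν hν1 i (fun ξ => ∑ z, G (z, ξ))
  simp only [← Finset.mul_sum] at h ⊢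
  rw [← h]
  refine Finset.sum_congr rfl fun ξ _ => ?_
  congr 1
  rw [Finset.sum_comm]
  refine Finset.sum_congr rfl fun s _ => ?_
  rw [← Finset.mul_sum]
  congr 1
  have := Equiv.sum_comp (Equiv.addRight (ξ i - s)) (fun z => G (z, Function.update ξ i s))
  rw [← this]
  refine Finset.sum_congr rfl fun z _ => ?_
  simp [add_sub_assoc]

lemma pw_sum (ν : ℕ → S → ℝ) (hν1 : ∀ i, ∑ s, ν i s = 1) :
    ∑ ξ : Fin N → S, pw ν ξ = 1 := by
  classical
  simp only [pw]
  rw [← Fintype.prod_sum (fun (k : Fin N) (s : S) => ν k s)]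
  simp [hν1]

lemma law (ν κ : ℕ → S → ℝ) (hν1 : ∀ i, ∑ s, ν i s = 1)
    (h0 : ∀ H : S → ℝ, ∑ s, κ 0 s * H s = H 0)
    (hκ : ∀ i < N, ∀ H : S → ℝ, ∑ s, κ (i+1) s * H s = ∑ x, κ i x * ∑ s, ν i s * H (x + s)) :
    ∀ i ≤ N, ∀ H : S → ℝ, ∑ ξ : Fin N → S, pw ν ξ * H (ps ξ i) = ∑ s, κ i s * H s := by
  intro i
  induction i with
  | zero =>
    intro _ H
    simp only [ps, Nat.not_lt_zero, if_false, Finset.sum_const_zero]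
    rw [← Finset.sum_mul, pw_sum ν hν1, one_mul, h0]
  | succ i ih =>
    intro hi H
    have hi' : i < N := hi
    rw [hκ i hi' H, ← ih hi'.le (fun x => ∑ s, ν i s * H (x + s)),
      ← resample ν hν1 ⟨i, hi'⟩ (fun ξ => H (ps ξ (i+1)))]
    refine Finset.sum_congr rfl fun ξ _ => ?_
    congr 1
    refine Finset.sum_congr rfl fun s _ => ?_
    congr 2
    have := ps_succ ξ ⟨i, hi'⟩
    simp only at this
    rw [ps_update_lt _ _ _ (by simp), this]
    abel

def Pop (κ : ℕ → S → ℝ) (F : S → ℝ) (i : ℕ) (y : S) : ℝ := ∑ s, κ i s * F (y + s)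

def Xp (κ : ℕ → S → ℝ) (F : S → ℝ) (ω : S × (Fin N → S)) (n : ℕ) : ℝ :=
  Pop κ F (N - n) (ω.1 + ps ω.2 (N - n))

lemma Xp_mart (ν κ : ℕ → S → ℝ) (F : S → ℝ) (hν1 : ∀ i, ∑ s, ν i s = 1)
    (hsym : ∀ i s, ν i (-s) = ν i s)
    (hκ : ∀ i < N, ∀ H : S → ℝ, ∑ s, κ (i+1) s * H s = ∑ x, κ i x * ∑ s, ν i s * H (x + s)) :
    Mart (fun ω : S × (Fin N → S) => pw ν ω.2) (Xp κ F) N := by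
  intro n hn h hh
  obtain ⟨i, hi⟩ : ∃ i, N - n = i + 1 := ⟨N - n - 1, by omega⟩
  have hi' : N - (n+1) = i := by omega
  have hiN : i < N := by omega
  simp only [mul_sub, Finset.sum_sub_distrib]
  rw [sub_eq_zero]
  rw [← resample2 ν hν1 ⟨i, hiN⟩]
  refine Finset.sum_congr rfl fun ω _ => ?_
  congr 1
  have e1 : ∀ s, h (Xp κ F (ω.1 + ω.2 ⟨i, hiN⟩ - s, Function.update ω.2 ⟨i, hiN⟩ s)) =
      h (Xp κ F ω) := by
    intro s
    refine hh _ _ fun m hm => ?_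
    simp only [Xp]
    rw [ps_update_lt _ _ _ (by simp; omega)]
    congr 1; abel
  have e2 : ∀ s, Xp κ F (ω.1 + ω.2 ⟨i, hiN⟩ - s, Function.update ω.2 ⟨i, hiN⟩ s) (n+1) =
      Pop κ F i (ω.1 + ps ω.2 (i+1) + -s) := by
    intro s
    have := ps_succ ω.2 ⟨i, hiN⟩
    simp only at this
    simp only [Xp, hi']
    rw [ps_update_ge _ _ _ (by simp), this]
    congr 1; abel
  simp only [e1, e2]
  have e3 : ∑ s, ν i s * Pop κ F i (ω.1 + ps ω.2 (i+1) + -s) = Xp κ F ω n := by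
    simp only [Xp, hi]
    rw [← Equiv.sum_comp (Equiv.neg S)]
    simp only [Equiv.neg_apply, hsym, neg_neg]
    simp only [Pop]
    rw [hκ i hiN]
    simp only [Finset.mul_sum]
    rw [Finset.sum_comm]
    refine Finset.sum_congr rfl fun x _ => Finset.sum_congr rfl fun s _ => ?_
    rw [mul_left_comm]
    congr 3; abel
  rw [← e3, Finset.mul_sum]
  exact Finset.sum_congr rfl fun s _ => by ring

end grp

theorem group_var {p r : ℝ} (hp : 1 < p) (hr : 2 < r) : ∃ C : ℝ, 0 < C ∧
    ∀ (S : Type) [Fintype S] [AddCommGroup S] (N : ℕ) (ν κ : ℕ → S → ℝ) (F : S → ℝ),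
    (∀ i s, 0 ≤ ν i s) → (∀ i s, 0 ≤ κ i s) →
    (∀ i, ∑ s, ν i s = 1) → (∀ i s, ν i (-s) = ν i s) →
    (∀ H : S → ℝ, ∑ s, κ 0 s * H s = H 0) →
    (∀ i < N, ∀ H : S → ℝ, ∑ s, κ (i+1) s * H s = ∑ x, κ i x * ∑ s, ν i s * H (x + s)) →
    (∀ s, 0 ≤ F s) →
    ∃ B : S → ℝ, (∀ z, 0 ≤ B z) ∧ (∀ z J (u : Fin (J+1) → ℕ), StrictMono u → (∀ j, u j ≤ N) →
      ∑ j : Fin J, |(∑ s, κ (u j.succ) s * ∑ s', κ (u j.succ) s' * F (z + s + s')) -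
        ∑ s, κ (u j.castSucc) s * ∑ s', κ (u j.castSucc) s' * F (z + s + s')|^r ≤ B z ^ r) ∧
      ∑ z, B z ^ p ≤ C * ∑ z, F z ^ p := by
  obtain ⟨C, hC, hL⟩ := lepingle hp hr
  refine ⟨C, hC, ?_⟩
  intro S _ _ N ν κ F hν0 hκ0 hν1 hsym h0 hκ hF
  have hpw : ∀ ξ : Fin N → S, 0 ≤ pw ν ξ := fun ξ => Finset.prod_nonneg fun k _ => hν0 _ _
  obtain ⟨B, hB0, hBv, hBp⟩ := hL (S × (Fin N → S)) (fun ω => pw ν ω.2) (Xp κ F) N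
    (fun ω => hpw _) (fun ω n => Finset.sum_nonneg fun s _ => mul_nonneg (hκ0 _ _) (hF _))
    (Xp_mart ν κ F hν1 hsym hκ)
  refine ⟨fun z => ∑ ξ, pw ν ξ * B (z, ξ), fun z => Finset.sum_nonneg fun ξ _ =>
    mul_nonneg (hpw _) (hB0 _), ?_, ?_⟩
  · intro z J u hu huN
    have hT : ∀ i ≤ N, ∑ s, κ i s * ∑ s', κ i s' * F (z + s + s') =
        ∑ ξ : Fin N → S, pw ν ξ * Xp κ F (z, ξ) (N - i) := by
      intro i hi
      rw [← law ν κ hν1 h0 hκ i hi (fun s => ∑ s', κ i s' * F (z + s + s'))]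
      simp only [Xp, Pop]
      rw [Nat.sub_sub_self hi]
    have hm := minkowski (r := r) (by linarith) (pw ν) hpw
      (fun ξ (j : Fin J) => Xp κ F (z, ξ) (N - u j.succ) - Xp κ F (z, ξ) (N - u j.castSucc))
      (fun ξ => B (z, ξ)) (fun ξ => hB0 _) ?_
    · refine le_trans (le_of_eq ?_) hm
      refine Finset.sum_congr rfl fun j _ => ?_
      rw [hT _ (huN _), hT _ (huN _), ← Finset.sum_sub_distrib]
      simp only [mul_sub]
    · intro ξ
      refine le_trans (le_of_eq ?_) (hBv (z, ξ) J (fun j => N - u j.rev) ?_ ?_)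
      · rw [← Equiv.sum_comp Fin.revPerm]
        refine Finset.sum_congr rfl fun j _ => ?_
        rw [Fin.revPerm_apply, Fin.rev_castSucc, Fin.rev_succ, abs_sub_comm]
      · intro a b hab
        have h1 := hu (Fin.rev_lt_rev.2 hab)
        have h2 := huN a.rev
        simp only
        omega
      · intro j; simp
  · have hlast : ∑ ω : S × (Fin N → S), pw ν ω.2 * (Xp κ F ω N)^p = ∑ z, F z ^ p := by
      have : ∀ ω : S × (Fin N → S), Xp κ F ω N = F ω.1 := by
        intro ω
        simp only [Xp, Pop, Nat.sub_self]
        rw [h0 (fun s => F (ω.1 + ps ω.2 0 + s))]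
        simp [ps]
      simp only [this]
      rw [Fintype.sum_prod_type]
      refine Finset.sum_congr rfl fun z _ => ?_
      simp only
      rw [← Finset.sum_mul, pw_sum ν hν1, one_mul]
    rw [hlast, Fintype.sum_prod_type] at hBp
    refine le_trans (Finset.sum_le_sum fun z _ => ?_) hBp
    exact jensen hp.le _ _ hpw (pw_sum ν hν1) (fun ξ => hB0 _)

end VG

namespace VG

noncomputable def fl (e : ℝ) (b : ZMod 2) : ℝ := if b = 0 then 1 - e else e

lemma sum_zmod2 (g : ZMod 2 → ℝ) : ∑ b, g b = g 0 + g 1 := Fin.sum_univ_two g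

lemma zmod2_cases (c : ZMod 2) : c = 0 ∨ c = 1 := by
  revert c; decide

lemma fl_nonneg {e : ℝ} (h0 : 0 ≤ e) (h1 : e ≤ 1) (b : ZMod 2) : 0 ≤ fl e b := by
  unfold fl; split_ifs <;> linarith

lemma fl_sum (e : ℝ) : ∑ b, fl e b = 1 := by
  rw [sum_zmod2]; simp [fl]

lemma fl_conv (e e' : ℝ) (c : ZMod 2) :
    ∑ b, fl e b * fl e' (c - b) = fl (e + e' - 2 * e * e') c := by
  rw [sum_zmod2]
  rcases zmod2_cases c with rfl | rfl
  · have h : (0 - 1 : ZMod 2) ≠ 0 := by decide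
    have h1 : (1 : ZMod 2) ≠ 0 := by decide
    simp only [fl, h, h1, sub_zero, if_true, if_false]; ring
  · have h1 : (1 : ZMod 2) ≠ 0 := by decide
    simp only [fl, h1, sub_self, sub_zero, if_true, if_false]; ring

noncomputable def ker {K : Type} [Fintype K] (η : K → ℝ) (s : K → ZMod 2) : ℝ := ∏ k, fl (η k) (s k)

lemma ker_nonneg {K : Type} [Fintype K] {η : K → ℝ} (h0 : ∀ k, 0 ≤ η k) (h1 : ∀ k, η k ≤ 1)
    (s : K → ZMod 2) : 0 ≤ ker η s := Finset.prod_nonneg fun k _ => fl_nonneg (h0 k) (h1 k) _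

lemma ker_sum {K : Type} [Fintype K] [DecidableEq K] (η : K → ℝ) : ∑ s, ker η s = 1 := by
  unfold ker
  rw [← Fintype.prod_sum (fun k b => fl (η k) b)]
  simp [fl_sum]

lemma ker_conv {K : Type} [Fintype K] [DecidableEq K] (η e : K → ℝ) (H : (K → ZMod 2) → ℝ) :
    ∑ s, ker (fun k => η k + e k - 2 * η k * e k) s * H s =
      ∑ x, ker η x * ∑ s, ker e s * H (x + s) := by
  have h1 : ∀ x : K → ZMod 2, ∑ s, ker e s * H (x + s) = ∑ y, ker e (y - x) * H y := by
    intro x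
    rw [← Equiv.sum_comp (Equiv.addLeft x) (fun y => ker e (y - x) * H y)]
    simp
  simp only [h1, Finset.mul_sum]
  rw [Finset.sum_comm]
  refine Finset.sum_congr rfl fun y _ => ?_
  simp only [← mul_assoc]
  rw [← Finset.sum_mul]
  congr 1
  unfold ker
  simp only [← Finset.prod_mul_distrib, Pi.sub_apply]
  rw [← Fintype.prod_sum (fun k b => fl (η k) b * fl (e k) (y k - b))]
  simp only [fl_conv]

theorem cube_var {p r : ℝ} (hp : 1 < p) (hr : 2 < r) : ∃ C : ℝ, 0 < C ∧
    ∀ (K : Type) [Fintype K] [DecidableEq K] (N : ℕ) (η : ℕ → K → ℝ) (F : (K → ZMod 2) → ℝ),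
    (∀ k, η 0 k = 0) → (∀ i k, 0 ≤ η i k) → (∀ i k, η i k < 1/2) → (∀ i k, η i k ≤ η (i+1) k) →
    (∀ s, 0 ≤ F s) →
    ∃ B : (K → ZMod 2) → ℝ, (∀ z, 0 ≤ B z) ∧
      (∀ z J (u : Fin (J+1) → ℕ), StrictMono u → (∀ j, u j ≤ N) →
      ∑ j : Fin J, |(∑ s, ker (η (u j.succ)) s * ∑ s', ker (η (u j.succ)) s' * F (z + s + s')) -
        ∑ s, ker (η (u j.castSucc)) s * ∑ s', ker (η (u j.castSucc)) s' * F (z + s + s')|^r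
          ≤ B z ^ r) ∧
      ∑ z, B z ^ p ≤ C * ∑ z, F z ^ p := by
  obtain ⟨C, hC, hG⟩ := group_var hp hr
  refine ⟨C, hC, ?_⟩
  intro K _ _ N η F h0 hn hl hm hF
  let e : ℕ → K → ℝ := fun i k => (η (i+1) k - η i k) / (1 - 2 * η i k)
  have hpos : ∀ i k, 0 < 1 - 2 * η i k := fun i k => by have := hl i k; linarith
  have he0 : ∀ i k, 0 ≤ e i k := fun i k => div_nonneg (sub_nonneg.2 (hm i k)) (hpos i k).le
  have he1 : ∀ i k, e i k ≤ 1 := fun i k => by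
    rw [div_le_one (hpos i k)]; have := hl i k; have := hl (i+1) k; linarith
  refine hG (K → ZMod 2) N (fun i => ker (e i)) (fun i => ker (η i)) F
    (fun i s => ker_nonneg (he0 i) (he1 i) s)
    (fun i s => ker_nonneg (hn i) (fun k => by have := hl i k; linarith) s)
    (fun i => ker_sum _) ?_ ?_ ?_ hF
  · intro i s
    have : -s = s := by
      funext k
      have : ∀ c : ZMod 2, -c = c := by decide
      exact this _
    rw [this]
  · intro H
    rw [Finset.sum_eq_single 0]
    · have : ker (η 0) (0 : K → ZMod 2) = 1 := by simp [ker, fl, h0]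
      rw [this, one_mul]
    · intro s _ hs
      obtain ⟨k, hk⟩ : ∃ k, s k ≠ 0 := by
        by_contra hcon
        push Not at hcon
        exact hs (funext hcon)
      have : ker (η 0) s = 0 := by
        refine Finset.prod_eq_zero (Finset.mem_univ k) ?_
        simp [fl, hk, h0]
      rw [this, zero_mul]
    · simp
  · intro i _ H
    rw [← ker_conv]
    refine Finset.sum_congr rfl fun s _ => ?_
    congr 2
    funext k
    have := (hpos i k).ne'
    have h : e i k * (1 - 2 * η i k) = η (i+1) k - η i k := div_mul_cancel₀ _ this
    linear_combination -h

end VG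

namespace VG

abbrev Cube (d M : ℕ) := Fin d × Fin M → ZMod 2

def Ds {d M : ℕ} (b : Cube d M) : Fin d → ℤ := fun j => ∑ m, ((b (j,m)).val : ℤ)

noncomputable def Tav {d M : ℕ} (η : ℕ → ℝ) (f : (Fin d → ℤ) → ℝ) (y : Fin d → ℤ) : ℝ :=
  ∑ b : Cube d M, ((Fintype.card (Cube d M) : ℝ)⁻¹) *
    ∑ s : Cube d M, ker (fun k => η k.2) s * ∑ s' : Cube d M, ker (fun k => η k.2) s' *
      f (y - Ds b + Ds (b + s + s'))

theorem cube_transfer {p r : ℝ} (hp : 1 < p) (hr : 2 < r) : ∃ C : ℝ, 0 < C ∧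
    ∀ (d M N : ℕ) (η : ℕ → ℕ → ℝ) (f : (Fin d → ℤ) → ℝ),
    (∀ k, η 0 k = 0) → (∀ i k, 0 ≤ η i k) → (∀ i k, η i k < 1/2) → (∀ i k, η i k ≤ η (i+1) k) →
    (∀ s, 0 ≤ f s) →
    ∃ B : (Fin d → ℤ) → ℝ, (∀ z, 0 ≤ B z) ∧
      (∀ z J (u : Fin (J+1) → ℕ), StrictMono u → (∀ j, u j ≤ N) →
      ∑ j : Fin J, |Tav (M := M) (η (u j.succ)) f z - Tav (M := M) (η (u j.castSucc)) f z|^r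
          ≤ B z ^ r) ∧
      ∑' z, ENNReal.ofReal (B z ^ p) ≤ ENNReal.ofReal C * ∑' z, ENNReal.ofReal (f z ^ p) := by
  obtain ⟨C, hC, hG⟩ := cube_var hp hr
  refine ⟨C, hC, ?_⟩
  intro d M N η f h0 hn hl hm hf
  have key := fun x : Fin d → ℤ => hG (Fin d × Fin M) N (fun i k => η i k.2)
    (fun b => f (x + Ds b)) (fun k => h0 _) (fun i k => hn _ _) (fun i k => hl _ _)
    (fun i k => hm _ _) (fun s => hf _)
  choose B hB0 hBv hBp using key
  set w : ℝ := (Fintype.card (Cube d M) : ℝ)⁻¹ with hw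
  have hw0 : 0 ≤ w := by positivity
  have hw1 : ∑ _b : Cube d M, w = 1 := by
    rw [Finset.sum_const, Finset.card_univ, nsmul_eq_mul, hw]
    exact mul_inv_cancel₀ (by positivity)
  refine ⟨fun y => ∑ b : Cube d M, w * B (y - Ds b) b, fun y => Finset.sum_nonneg fun b _ =>
    mul_nonneg hw0 (hB0 _ _), ?_, ?_⟩
  · intro y J u hu huN
    have hmk := minkowski (r := r) (by linarith) (fun _ : Cube d M => w) (fun _ => hw0)
      (fun b (j : Fin J) => (∑ s : Cube d M, ker (fun k => η (u j.succ) k.2) s *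
        ∑ s' : Cube d M, ker (fun k => η (u j.succ) k.2) s' * f (y - Ds b + Ds (b + s + s'))) -
        ∑ s : Cube d M, ker (fun k => η (u j.castSucc) k.2) s *
        ∑ s' : Cube d M, ker (fun k => η (u j.castSucc) k.2) s' * f (y - Ds b + Ds (b + s + s')))
      (fun b => B (y - Ds b) b) (fun b => hB0 _ _) (fun b => hBv (y - Ds b) b J u hu huN)
    refine le_trans (le_of_eq ?_) hmk
    refine Finset.sum_congr rfl fun j _ => ?_
    simp only [Tav, mul_sub, Finset.sum_sub_distrib, ← hw]
  · have e1 : ∀ y, ENNReal.ofReal ((∑ b : Cube d M, w * B (y - Ds b) b)^p) ≤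
        ∑ b : Cube d M, ENNReal.ofReal (w * B (y - Ds b) b ^ p) := by
      intro y
      rw [← ENNReal.ofReal_sum_of_nonneg (fun b _ => mul_nonneg hw0 (Real.rpow_nonneg (hB0 _ _) _))]
      exact ENNReal.ofReal_le_ofReal (jensen hp.le _ _ (fun _ => hw0) hw1 (fun b => hB0 _ _))
    have e2 : ∀ x, ∑ b : Cube d M, ENNReal.ofReal (w * B x b ^ p) ≤
        ∑ b : Cube d M, ENNReal.ofReal w * (ENNReal.ofReal C * ENNReal.ofReal (f (x + Ds b) ^ p)) := by
      intro x
      rw [← ENNReal.ofReal_sum_of_nonneg (fun b _ => mul_nonneg hw0 (Real.rpow_nonneg (hB0 _ _) _))]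
      simp_rw [← ENNReal.ofReal_mul hC.le, ← ENNReal.ofReal_mul hw0]
      rw [← ENNReal.ofReal_sum_of_nonneg (fun b _ => mul_nonneg hw0 (mul_nonneg hC.le
        (Real.rpow_nonneg (hf _) _)))]
      refine ENNReal.ofReal_le_ofReal ?_
      rw [← Finset.mul_sum, ← Finset.mul_sum, ← Finset.mul_sum]
      exact mul_le_mul_of_nonneg_left (hBp x) hw0
    have s1 : ∀ b : Cube d M, ∑' y, ENNReal.ofReal (w * B (y - Ds b) b ^ p) =
        ∑' x, ENNReal.ofReal (w * B x b ^ p) := fun b =>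
      Equiv.tsum_eq (Equiv.subRight (Ds b)) (fun x => ENNReal.ofReal (w * B x b ^ p))
    have s2 : ∀ b : Cube d M, ∑' x, ENNReal.ofReal (f (x + Ds b) ^ p) =
        ∑' x, ENNReal.ofReal (f x ^ p) := fun b =>
      Equiv.tsum_eq (Equiv.addRight (Ds b)) (fun x => ENNReal.ofReal (f x ^ p))
    calc ∑' y, ENNReal.ofReal ((∑ b : Cube d M, w * B (y - Ds b) b)^p)
        ≤ ∑' y, ∑ b : Cube d M, ENNReal.ofReal (w * B (y - Ds b) b ^ p) := ENNReal.tsum_le_tsum e1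
      _ = ∑ b : Cube d M, ∑' y, ENNReal.ofReal (w * B (y - Ds b) b ^ p) :=
          Summable.tsum_finsetSum fun _ _ => ENNReal.summable
      _ = ∑ b : Cube d M, ∑' x, ENNReal.ofReal (w * B x b ^ p) := by simp only [s1]
      _ = ∑' x, ∑ b : Cube d M, ENNReal.ofReal (w * B x b ^ p) :=
          (Summable.tsum_finsetSum fun _ _ => ENNReal.summable).symm
      _ ≤ ∑' x, ∑ b : Cube d M, ENNReal.ofReal w *
          (ENNReal.ofReal C * ENNReal.ofReal (f (x + Ds b) ^ p)) := ENNReal.tsum_le_tsum e2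
      _ = ∑ b : Cube d M, ∑' x, ENNReal.ofReal w *
          (ENNReal.ofReal C * ENNReal.ofReal (f (x + Ds b) ^ p)) :=
          Summable.tsum_finsetSum fun _ _ => ENNReal.summable
      _ = ∑ b : Cube d M, ENNReal.ofReal w * (ENNReal.ofReal C * ∑' x, ENNReal.ofReal (f x ^ p)) := by
          simp only [ENNReal.tsum_mul_left, s2]
      _ = ENNReal.ofReal C * ∑' x, ENNReal.ofReal (f x ^ p) := by
          rw [← Finset.sum_mul, ← ENNReal.ofReal_sum_of_nonneg (fun _ _ => hw0), hw1]
          simp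

/-- law -/
abbrev Om := ZMod 2 × ZMod 2 × ZMod 2

noncomputable def gw (e : ℝ) (o : Om) : ℝ := (1/2) * (fl e o.2.1 * fl e o.2.2)

def dis (o : Om) : ℤ := ((o.1 + o.2.1 + o.2.2).val : ℤ) - (o.1.val : ℤ)

noncomputable def pmf1 (η : ℕ → ℝ) (M : ℕ) (n : ℤ) : ℝ :=
  ∑ ω : Fin M → Om, (∏ m : Fin M, gw (η m) (ω m)) * (if ∑ m, dis (ω m) = n then 1 else 0)

lemma Tav_eq {d M : ℕ} (η : ℕ → ℝ) (f : (Fin d → ℤ) → ℝ) (y : Fin d → ℤ) :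
    Tav (M := M) η f y = ∑ ω : Fin d → Fin M → Om, (∏ j, ∏ m : Fin M, gw (η m) (ω j m)) *
      f (y + fun j => ∑ m, dis (ω j m)) := by
  unfold Tav
  let E : (Cube d M × Cube d M × Cube d M) ≃ (Fin d → Fin M → Om) :=
    { toFun := fun t j m => (t.1 (j,m), t.2.1 (j,m), t.2.2 (j,m))
      invFun := fun ω => (fun k => (ω k.1 k.2).1, fun k => (ω k.1 k.2).2.1, fun k => (ω k.1 k.2).2.2)
      left_inv := fun t => rfl
      right_inv := fun t => rfl }
  rw [← Equiv.sum_comp E, Fintype.sum_prod_type]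
  refine Finset.sum_congr rfl fun b _ => ?_
  rw [Fintype.sum_prod_type, Finset.mul_sum]
  refine Finset.sum_congr rfl fun s _ => ?_
  rw [Finset.mul_sum, Finset.mul_sum]
  refine Finset.sum_congr rfl fun s' _ => ?_
  have h1 : (∏ j, ∏ m : Fin M, gw (η m) (E (b, s, s') j m)) =
      (Fintype.card (Cube d M) : ℝ)⁻¹ * (ker (fun k => η k.2) s * ker (fun k => η k.2) s') := by
    rw [← Fintype.prod_prod_type' (fun j (m : Fin M) => gw (η m) (E (b, s, s') j m))]
    simp only [gw, E, Equiv.coe_fn_mk, Finset.prod_mul_distrib]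
    unfold ker
    congr 1
    simp [ZMod.card]
  have h2 : (y + fun j => ∑ m, dis (E (b, s, s') j m)) = y - Ds b + Ds (b + s + s') := by
    funext j
    simp only [dis, E, Equiv.coe_fn_mk, Finset.sum_sub_distrib, Ds, Pi.add_apply, Pi.sub_apply]
    ring
  rw [h1, h2]; ring

lemma Tav_law {d M : ℕ} (η : ℕ → ℝ) (f : (Fin d → ℤ) → ℝ) (y : Fin d → ℤ) :
    Tav (M := M) η f y = ∑' n : Fin d → ℤ, (∏ j, pmf1 η M (n j)) * f (y + n) := by
  have hp : ∀ n : Fin d → ℤ, ∏ j, pmf1 η M (n j) = ∑ ω : Fin d → Fin M → Om,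
      (∏ j, ∏ m : Fin M, gw (η m) (ω j m)) * (if (fun j => ∑ m, dis (ω j m)) = n then 1 else 0) := by
    intro n
    unfold pmf1
    rw [Fintype.prod_sum]
    refine Finset.sum_congr rfl fun ω _ => ?_
    rw [Finset.prod_mul_distrib]
    congr 1
    rw [Finset.prod_ite_zero]
    simp [funext_iff]
  simp only [hp, Finset.sum_mul]
  have hs : ∀ ω : Fin d → Fin M → Om, ∀ n : Fin d → ℤ,
     (∏ j, ∏ m : Fin M, gw (η m) (ω j m)) * (if (fun j => ∑ m, dis (ω j m)) = n then 1 else 0)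
      * f (y + n) = if n = (fun j => ∑ m, dis (ω j m)) then
      (∏ j, ∏ m : Fin M, gw (η m) (ω j m)) * f (y + fun j => ∑ m, dis (ω j m)) else 0 := by
    intro ω n
    by_cases h : n = (fun j => ∑ m, dis (ω j m))
    · simp [h]
    · rw [if_neg h, if_neg (Ne.symm h)]; simp
  simp only [hs]
  rw [Summable.tsum_finsetSum]
  · rw [Tav_eq]
    refine Finset.sum_congr rfl fun ω _ => ?_
    rw [tsum_ite_eq]
  · intro ω _
    exact (hasSum_ite_eq _ _).summable

lemma pmf1_zero (η : ℕ → ℝ) (n : ℤ) : pmf1 η 0 n = if n = 0 then 1 else 0 := by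
  simp [pmf1, eq_comm]

lemma pmf1_succ (η : ℕ → ℝ) (M : ℕ) (n : ℤ) :
    pmf1 η (M+1) n = ∑ o, gw (η M) o * pmf1 η M (n - dis o) := by
  unfold pmf1
  rw [← Equiv.sum_comp (Fin.snocEquiv (fun _ => Om)), Fintype.sum_prod_type]
  refine Finset.sum_congr rfl fun o _ => ?_
  rw [Finset.mul_sum]
  refine Finset.sum_congr rfl fun ω _ => ?_
  rw [Fin.prod_univ_castSucc, Fin.sum_univ_castSucc]
  simp only [Fin.snocEquiv, Equiv.coe_fn_mk, Fin.snoc_castSucc, Fin.snoc_last, Fin.val_castSucc, Fin.val_last,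
    eq_sub_iff_add_eq]
  ring

lemma om_sum (e : ℝ) (h : ℤ → ℝ) : ∑ o, gw e o * h (dis o) =
    (1 - 2 * e * (1 - e)) * h 0 + e * (1 - e) * (h 1 + h (-1)) := by
  simp only [Om, Fintype.sum_prod_type, sum_zmod2]
  have hd : dis (0,0,0) = 0 ∧ dis (0,0,1) = 1 ∧ dis (0,1,0) = 1 ∧ dis (0,1,1) = 0 ∧
    dis (1,0,0) = 0 ∧ dis (1,0,1) = -1 ∧ dis (1,1,0) = -1 ∧ dis (1,1,1) = 0 := by decide
  obtain ⟨h1,h2,h3,h4,h5,h6,h7,h8⟩ := hd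
  have h10 : (1 : ZMod 2) ≠ 0 := by decide
  rw [h1,h2,h3,h4,h5,h6,h7,h8]
  simp only [gw, fl, h10, if_true, if_false]
  ring

lemma pmf1_rec (η : ℕ → ℝ) (M : ℕ) (n : ℤ) :
    pmf1 η (M+1) n = (1 - 2 * η M * (1 - η M)) * pmf1 η M n
      + η M * (1 - η M) * (pmf1 η M (n-1) + pmf1 η M (n+1)) := by
  rw [pmf1_succ, om_sum (η M) (fun k => pmf1 η M (n - k))]
  simp

end VG

namespace VG

noncomputable def Qf (q : ℝ) (n : ℕ) : ℝ := ∏ l ∈ Finset.range n, (1 - q^(2*(l+1)))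

noncomputable def uf (q : ℝ) (k : ℤ) : ℝ := if k < 0 then 0 else (Qf q k.toNat)⁻¹

lemma Qf_pos {q : ℝ} (h0 : 0 < q) (h1 : q < 1) (n : ℕ) : 0 < Qf q n := by
  refine Finset.prod_pos fun l _ => ?_
  have : q^(2*(l+1)) < 1 := pow_lt_one₀ h0.le h1 (by omega)
  linarith

lemma uf_nonneg {q : ℝ} (h0 : 0 < q) (h1 : q < 1) (k : ℤ) : 0 ≤ uf q k := by
  unfold uf; split_ifs
  · exact le_rfl
  · exact (inv_pos.2 (Qf_pos h0 h1 _)).le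

lemma uf_pos {q : ℝ} (h0 : 0 < q) (h1 : q < 1) {k : ℤ} (hk : 0 ≤ k) : 0 < uf q k := by
  unfold uf; rw [if_neg (by omega)]
  exact (inv_pos.2 (Qf_pos h0 h1 _))

lemma uf_rec {q : ℝ} (h0 : 0 < q) (h1 : q < 1) (k : ℤ) :
    uf q (k-1) = (1 - q^(2*k)) * uf q k := by
  rcases lt_trichotomy k 0 with h | h | h
  · simp [uf, h, (by omega : k - 1 < 0)]
  · subst h; simp [uf]
  · obtain ⟨n, rfl⟩ : ∃ n : ℕ, k = n + 1 := ⟨(k-1).toNat, by omega⟩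
    have e1 : ((n:ℤ) + 1 - 1) = n := by ring
    have e2 : ((n:ℤ)+1) = ((n+1 : ℕ) : ℤ) := by push_cast; ring
    have e3 : q^(2*((n:ℤ)+1)) = q^(2*(n+1)) := by
      rw [← zpow_natCast]; push_cast; rfl
    have hq : (1 - q^(2*(n+1))) ≠ 0 := by
      have : q^(2*(n+1)) < 1 := pow_lt_one₀ h0.le h1 (by omega)
      linarith
    rw [e1, e3, e2]
    unfold uf
    rw [if_neg (by omega), if_neg (by omega), Int.toNat_natCast, Int.toNat_natCast]
    unfold Qf
    rw [Finset.prod_range_succ, mul_inv]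
    field_simp

noncomputable def aq (q : ℝ) (m : ℕ) : ℝ := q^(2*m+1)

noncomputable def etq (q : ℝ) (m : ℕ) : ℝ := aq q m / (1 + aq q m)

noncomputable def Af (q : ℝ) (M : ℕ) : ℝ := Qf q (2*M) / ∏ m ∈ Finset.range M, (1 + aq q m)^2

lemma pmf1_closed {q : ℝ} (h0 : 0 < q) (h1 : q < 1) (M : ℕ) : ∀ n : ℤ,
    pmf1 (etq q) M n = Af q M * (q^(n^2) * (uf q (M - n) * uf q (M + n))) := by
  have hq0 : q ≠ 0 := h0.ne'
  induction M with
  | zero =>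
    intro n
    rw [pmf1_zero]
    rcases lt_trichotomy n 0 with h | h | h
    · rw [if_neg (by omega)]
      have : uf q ((0:ℕ) + n) = 0 := by simp [uf, h]
      rw [this]; ring
    · subst h; simp [Af, Qf, uf]
    · rw [if_neg (by omega)]
      have : uf q ((0:ℕ) - n) = 0 := by simp [uf, h]
      rw [this]; ring
  | succ M ih =>
    intro n
    rw [pmf1_rec, ih, ih, ih]
    set a := aq q M with ha
    have hapos : 0 < a := pow_pos h0 _
    set U := uf q ((M+1 : ℕ) - n) with hU
    set V := uf q ((M+1 : ℕ) + n) with hV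
    set α := q^(2*((M:ℤ)+1-n)) with hα
    set β := q^(2*((M:ℤ)+1+n)) with hβ
    have r1 : uf q (M - n) = (1-α)*U := by
      rw [hU, hα]; have := uf_rec h0 h1 ((M:ℤ)+1-n)
      rw [← (by ring : (M:ℤ)+1-n-1 = M - n), this]; push_cast; rfl
    have r2 : uf q (M + n) = (1-β)*V := by
      rw [hV, hβ]; have := uf_rec h0 h1 ((M:ℤ)+1+n)
      rw [← (by ring : (M:ℤ)+1+n-1 = M + n), this]; push_cast; rfl
    have r3 : uf q (M - (n-1)) = U := by rw [hU]; congr 1; push_cast; ring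
    have r4 : uf q (M + (n+1)) = V := by rw [hV]; congr 1; push_cast; ring
    have hα2 : q^(2*((M:ℤ)-n)) = α / q^2 := by
      rw [hα, ← zpow_natCast q 2, ← zpow_sub₀ hq0]; congr 1; push_cast; ring
    have hβ2 : q^(2*((M:ℤ)+n)) = β / q^2 := by
      rw [hβ, ← zpow_natCast q 2, ← zpow_sub₀ hq0]; congr 1; push_cast; ring
    have r5 : uf q (M - (n+1)) = (1 - α/q^2)*((1-α)*U) := by
      rw [← r1, ← hα2, ← uf_rec h0 h1]; congr 1; ring
    have r6 : uf q (M + (n-1)) = (1 - β/q^2)*((1-β)*V) := by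
      rw [← r2, ← hβ2, ← uf_rec h0 h1]; congr 1; ring
    have x1 : a * q^((n-1)^2) = α * q^(n^2) := by
      rw [ha, hα, aq, ← zpow_natCast, ← zpow_add₀ hq0, ← zpow_add₀ hq0]; congr 1; push_cast; ring
    have x2 : a * q^((n+1)^2) = β * q^(n^2) := by
      rw [ha, hβ, aq, ← zpow_natCast, ← zpow_add₀ hq0, ← zpow_add₀ hq0]; congr 1; push_cast; ring
    have x3 : α * β = a^2 * q^2 := by
      rw [ha, hα, hβ, aq, ← pow_mul, ← pow_add, ← zpow_natCast, ← zpow_add₀ hq0]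
      congr 1; push_cast; ring
    have hQ : Qf q (2*(M+1)) = Qf q (2*M) * (1 - a^2) * (1 - a^2 * q^2) := by
      unfold Qf
      rw [show 2*(M+1) = 2*M+1+1 by ring, Finset.prod_range_succ, Finset.prod_range_succ]
      rw [ha, aq]; congr 2
      · congr 1; rw [← pow_mul]; congr 1; ring
      · congr 1; rw [← pow_mul, ← pow_add]; congr 1; ring
    have hA : Af q (M+1) = Af q M * ((1 - a^2) * (1 - a^2 * q^2)) / (1+a)^2 := by
      unfold Af
      rw [hQ, Finset.prod_range_succ, ← ha]
      have : (∏ m ∈ Finset.range M, (1 + aq q m)^2) ≠ 0 :=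
        (Finset.prod_pos fun m _ => by have : 0 < aq q m := pow_pos h0 _; positivity).ne'
      field_simp
    have he : etq q M * (1 - etq q M) = a / (1+a)^2 := by
      rw [etq, ← ha]; field_simp; ring
    have he2 : 1 - 2 * etq q M * (1 - etq q M) = (1 + a^2)/(1+a)^2 := by
      rw [mul_assoc, he]; field_simp; ring
    have id1 : (1 - a^2) * (1 - a^2*q^2) = (1+a^2)*((1-α)*(1-β)) + α * ((1-β/q^2)*(1-β))
        + β * ((1-α/q^2)*(1-α)) := by
      have hd : a^2 = α*β/q^2 := by rw [x3]; field_simp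
      rw [← x3, hd]; field_simp; ring
    rw [he, he2, r1, r2, r3, r4, r5, r6, hA]
    calc (1 + a^2)/(1+a)^2 * (Af q M * (q^(n^2) * ((1-α)*U*((1-β)*V)))) + a/(1+a)^2 *
        (Af q M * (q^((n-1)^2) * (U * ((1 - β/q^2)*((1-β)*V)))) +
          Af q M * (q^((n+1)^2) * ((1 - α/q^2)*((1-α)*U) * V)))
      = Af q M / (1+a)^2 * U * V * ((1+a^2) * ((1-α)*(1-β)) * q^(n^2) +
        (a * q^((n-1)^2)) * ((1 - β/q^2)*(1-β)) + (a * q^((n+1)^2)) * ((1 - α/q^2)*(1-α))) := by ring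
      _ = Af q M / (1+a)^2 * U * V * q^(n^2) * ((1+a^2)*((1-α)*(1-β)) + α * ((1-β/q^2)*(1-β))
        + β * ((1-α/q^2)*(1-α))) := by rw [x1, x2]; ring
      _ = _ := by rw [← id1]; ring

noncomputable def sf (q : ℝ) (M : ℕ) (n : ℤ) : ℝ := uf q (M - n) * uf q (M + n) / (uf q M)^2

lemma pmf1_sf {q : ℝ} (h0 : 0 < q) (h1 : q < 1) (M : ℕ) (n : ℤ) :
    pmf1 (etq q) M n = pmf1 (etq q) M 0 * (q^(n^2) * sf q M n) := by
  rw [pmf1_closed h0 h1, pmf1_closed h0 h1]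
  have := (uf_pos h0 h1 (k := (M:ℤ)) (by omega)).ne'
  simp only [sf, sub_zero, add_zero]
  field_simp
  simp

lemma sf_nonneg {q : ℝ} (h0 : 0 < q) (h1 : q < 1) (M : ℕ) (n : ℤ) : 0 ≤ sf q M n :=
  div_nonneg (mul_nonneg (uf_nonneg h0 h1 _) (uf_nonneg h0 h1 _)) (sq_nonneg _)

lemma sf_neg (q : ℝ) (M : ℕ) (n : ℤ) : sf q M (-n) = sf q M n := by
  unfold sf
  rw [sub_neg_eq_add, ← sub_eq_add_neg, mul_comm (uf q (M+n))]

lemma sf_zero {q : ℝ} (h0 : 0 < q) (h1 : q < 1) (M : ℕ) : sf q M 0 = 1 := by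
  have := (uf_pos h0 h1 (k := (M:ℤ)) (by omega)).ne'
  simp only [sf, sub_zero, add_zero]
  field_simp

lemma sf_succ {q : ℝ} (h0 : 0 < q) (h1 : q < 1) (M n : ℕ) :
    sf q M (n+1) = sf q M n * ((1 - q^(2*((M:ℤ)-n))) / (1 - q^(2*((M:ℤ)+n+1)))) := by
  have e1 : uf q ((M:ℤ) - (n+1)) = (1 - q^(2*((M:ℤ)-n))) * uf q (M-n) := by
    rw [← uf_rec h0 h1]; congr 1; ring
  have e2 : uf q ((M:ℤ)+n) = (1 - q^(2*((M:ℤ)+n+1))) * uf q (M+(n+1)) := by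
    rw [← add_assoc, ← uf_rec h0 h1]; congr 1; ring
  have h3 : q^(2*((M:ℤ)+n+1)) < 1 := zpow_lt_one₀ h0 h1 (by omega)
  have h4 : (1 - q^(2*((M:ℤ)+n+1))) ≠ 0 := by linarith
  unfold sf
  rw [e1, e2]
  field_simp

lemma sf_le_nat {q : ℝ} (h0 : 0 < q) (h1 : q < 1) (M n : ℕ) : sf q M n ≤ 1 := by
  induction n with
  | zero => simp [sf_zero h0 h1]
  | succ n ih =>
    push_cast
    by_cases h : (n:ℤ) ≤ M
    · rw [sf_succ h0 h1]
      have h3 : q^(2*((M:ℤ)+n+1)) < 1 := zpow_lt_one₀ h0 h1 (by omega)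
      have h4 : q^(2*((M:ℤ)+n+1)) ≤ q^(2*((M:ℤ)-n)) :=
        zpow_le_zpow_right_of_le_one₀ h0 h1.le (by omega)
      have h5 : q^(2*((M:ℤ)-n)) ≤ 1 := zpow_le_one₀ h0 h1.le (by omega)
      refine mul_le_one₀ ih (div_nonneg (by linarith) (by linarith)) ?_
      rw [div_le_one (by linarith)]; linarith
    · have : sf q M (n+1) = 0 := by
        unfold sf
        rw [show uf q ((M:ℤ) - (n+1)) = 0 by unfold uf; rw [if_pos (by omega)]]
        simp
      rw [this]; norm_num

lemma sf_le {q : ℝ} (h0 : 0 < q) (h1 : q < 1) (M : ℕ) (n : ℤ) : sf q M n ≤ 1 := by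
  obtain ⟨k, rfl | rfl⟩ := Int.eq_nat_or_neg n
  · exact sf_le_nat h0 h1 M k
  · rw [sf_neg]; exact sf_le_nat h0 h1 M k

lemma zpow_lim {q : ℝ} (h0 : 0 < q) (h1 : q < 1) (c : ℤ) :
    Filter.Tendsto (fun M : ℕ => q^(2*((M:ℤ)+c))) Filter.atTop (nhds 0) := by
  have h : ∀ M : ℕ, q^(2*((M:ℤ)+c)) = (q^2)^M * q^(2*c) := by
    intro M
    rw [← pow_mul, ← zpow_natCast, ← zpow_add₀ h0.ne']; congr 1; push_cast; ring
  simp only [h]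
  have := (tendsto_pow_atTop_nhds_zero_of_lt_one (r := q^2) (by positivity)
    (pow_lt_one₀ h0.le h1 (by norm_num))).mul_const (q^(2*c))
  simpa using this

lemma sf_lim_nat {q : ℝ} (h0 : 0 < q) (h1 : q < 1) (n : ℕ) :
    Filter.Tendsto (fun M : ℕ => sf q M n) Filter.atTop (nhds 1) := by
  induction n with
  | zero => simp [sf_zero h0 h1]
  | succ n ih =>
    push_cast
    simp only [sf_succ h0 h1]
    have t1 := (zpow_lim h0 h1 (-(n:ℤ))).const_sub 1
    have t2 := (zpow_lim h0 h1 ((n:ℤ)+1)).const_sub 1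
    have := ih.mul (t1.div t2 (by norm_num))
    simpa [← sub_eq_add_neg, ← add_assoc] using this

lemma sf_lim {q : ℝ} (h0 : 0 < q) (h1 : q < 1) (n : ℤ) :
    Filter.Tendsto (fun M : ℕ => sf q M n) Filter.atTop (nhds 1) := by
  obtain ⟨k, rfl | rfl⟩ := Int.eq_nat_or_neg n
  · exact sf_lim_nat h0 h1 k
  · simp only [sf_neg]; exact sf_lim_nat h0 h1 k

lemma summable_sq {q : ℝ} (h0 : 0 < q) (h1 : q < 1) : Summable (fun n : ℤ => q^(n^2)) := by
  have hg : Summable (fun n : ℕ => q^((n:ℤ)^2)) := by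
    refine Summable.of_nonneg_of_le (fun n => (zpow_pos h0 _).le) (fun n => ?_)
      (summable_geometric_of_lt_one h0.le h1)
    rw [← zpow_natCast]
    refine zpow_le_zpow_right_of_le_one₀ h0 h1.le ?_
    exact Int.le_self_sq _
  refine Summable.of_nat_of_neg hg ?_
  simpa using hg

lemma pmf1_hasSum (η : ℕ → ℝ) (M : ℕ) : HasSum (pmf1 η M) 1 := by
  have h1 : ∑ ω : Fin M → Om, (∏ m : Fin M, gw (η m) (ω m)) = 1 := by
    rw [← Fintype.prod_sum (fun (m : Fin M) o => gw (η m) o)]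
    refine Finset.prod_eq_one fun m _ => ?_
    have := om_sum (η m) (fun _ => 1)
    simp only [mul_one] at this
    rw [this]; ring
  rw [← h1]
  unfold pmf1
  refine hasSum_sum fun ω _ => ?_
  have : (fun n : ℤ => (∏ m : Fin M, gw (η m) (ω m)) * (if ∑ m, dis (ω m) = n then (1:ℝ) else 0)) =
      fun n => if n = ∑ m, dis (ω m) then (∏ m : Fin M, gw (η m) (ω m)) else 0 := by
    funext n
    by_cases h : n = ∑ m, dis (ω m)
    · simp [h]
    · rw [if_neg h, if_neg (Ne.symm h), mul_zero]
  rw [this]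
  exact hasSum_ite_eq _ _

lemma etq_nonneg {q : ℝ} (h0 : 0 < q) (m : ℕ) : 0 ≤ etq q m := by
  have : 0 < aq q m := pow_pos h0 _
  unfold etq; positivity

lemma etq_lt {q : ℝ} (h0 : 0 < q) (h1 : q < 1) (m : ℕ) : etq q m < 1/2 := by
  have : 0 < aq q m := pow_pos h0 _
  have h2 : aq q m < 1 := pow_lt_one₀ h0.le h1 (by omega)
  unfold etq; rw [div_lt_div_iff₀ (by linarith) (by norm_num)]; linarith

lemma etq_mono {q q' : ℝ} (h0 : 0 < q) (h : q ≤ q') (m : ℕ) : etq q m ≤ etq q' m := by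
  have h1 : 0 < aq q m := pow_pos h0 _
  have h3 : aq q m ≤ aq q' m := pow_le_pow_left₀ h0.le h _
  unfold etq; rw [div_le_div_iff₀ (by linarith) (by linarith)]; nlinarith

lemma pmf1_nonneg {q : ℝ} (h0 : 0 < q) (h1 : q < 1) (M : ℕ) (n : ℤ) : 0 ≤ pmf1 (etq q) M n := by
  refine Finset.sum_nonneg fun ω _ => mul_nonneg (Finset.prod_nonneg fun m _ => ?_) (by split_ifs <;> norm_num)
  have := etq_nonneg h0 m
  have h2 := etq_lt h0 h1 m
  unfold gw
  have := fl_nonneg this (by linarith) (ω m).2.1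
  have := fl_nonneg (etq_nonneg h0 m) (by linarith) (ω m).2.2
  positivity

lemma pmf1_le {q : ℝ} (h0 : 0 < q) (h1 : q < 1) (M : ℕ) (n : ℤ) : pmf1 (etq q) M n ≤ q^(n^2) := by
  rw [pmf1_sf h0 h1]
  have a1 : pmf1 (etq q) M 0 ≤ 1 := le_hasSum (pmf1_hasSum _ M) 0 (fun j _ => pmf1_nonneg h0 h1 M j)
  have a2 := sf_le h0 h1 M n
  have a3 := sf_nonneg h0 h1 M n
  have a4 : 0 < q^(n^2) := zpow_pos h0 _
  have a5 := pmf1_nonneg h0 h1 M 0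
  calc _ ≤ 1 * (q^(n^2) * 1) := by gcongr
    _ = _ := by ring

lemma pmf1_lim {q : ℝ} (h0 : 0 < q) (h1 : q < 1) (n : ℤ) :
    Filter.Tendsto (fun M : ℕ => pmf1 (etq q) M n) Filter.atTop
      (nhds ((∑' k : ℤ, q^(k^2))⁻¹ * q^(n^2))) := by
  have t1 : Filter.Tendsto (fun M : ℕ => ∑' k : ℤ, q^(k^2) * sf q M k) Filter.atTop
      (nhds (∑' k : ℤ, q^(k^2))) := by
    refine tendsto_tsum_of_dominated_convergence (summable_sq h0 h1) (fun k => ?_) ?_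
    · simpa using (sf_lim h0 h1 k).const_mul (q^(k^2))
    · refine Filter.Eventually.of_forall fun M k => ?_
      have a4 : 0 < q^(k^2) := zpow_pos h0 _
      rw [Real.norm_of_nonneg (mul_nonneg a4.le (sf_nonneg h0 h1 M k))]
      exact mul_le_of_le_one_right a4.le (sf_le h0 h1 M k)
  have hpos : 0 < ∑' k : ℤ, q^(k^2) :=
    (summable_sq h0 h1).tsum_pos (fun k => (zpow_pos h0 _).le) 0 (zpow_pos h0 _)
  have hz : ∀ M : ℕ, pmf1 (etq q) M 0 = (∑' k : ℤ, q^(k^2) * sf q M k)⁻¹ := by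
    intro M
    have := (pmf1_hasSum (etq q) M).tsum_eq
    rw [tsum_congr (fun n => pmf1_sf h0 h1 M n)] at this
    rw [tsum_mul_left] at this
    exact eq_inv_of_mul_eq_one_left this
  have t2 := t1.inv₀ hpos.ne'
  have t3 : Filter.Tendsto (fun M : ℕ => q^(n^2) * sf q M n) Filter.atTop (nhds (q^(n^2))) := by
    simpa using (sf_lim h0 h1 n).const_mul (q^(n^2))
  refine (t2.mul t3).congr fun M => ?_
  rw [← hz, ← pmf1_sf h0 h1]

lemma summable_pi_prod (φ : ℤ → ℝ) (h0 : ∀ n, 0 ≤ φ n) (hs : Summable φ) (d : ℕ) :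
    Summable (fun n : Fin d → ℤ => ∏ j, φ (n j)) := by
  induction d with
  | zero => exact Summable.of_finite
  | succ d ih =>
    rw [← Equiv.summable_iff (Fin.consEquiv (fun _ => ℤ))]
    have := hs.mul_of_nonneg ih h0 (fun n => Finset.prod_nonneg fun j _ => h0 _)
    refine this.congr fun x => ?_
    simp [Fin.consEquiv, Fin.prod_univ_succ]

lemma Tav_lim {q : ℝ} (h0 : 0 < q) (h1 : q < 1) (d : ℕ) (f : (Fin d → ℤ) → ℝ) (c : ℝ)
    (hf : ∀ x, |f x| ≤ c) (y : Fin d → ℤ) :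
    Filter.Tendsto (fun M : ℕ => Tav (M := M) (etq q) f y) Filter.atTop
      (nhds (∑' n : Fin d → ℤ, (∏ j, ((∑' k : ℤ, q^(k^2))⁻¹ * q^((n j)^2))) * f (y + n))) := by
  simp only [Tav_law]
  refine tendsto_tsum_of_dominated_convergence
    ((summable_pi_prod _ (fun n => (zpow_pos h0 (n^2)).le) (summable_sq h0 h1) d).mul_right c)
    (fun n => ?_) ?_
  · exact (tendsto_finsetProd _ fun j _ => pmf1_lim h0 h1 (n j)).mul_const _
  · refine Filter.Eventually.of_forall fun M n => ?_
    rw [norm_mul, Real.norm_of_nonneg (Finset.prod_nonneg fun j _ => pmf1_nonneg h0 h1 M _)]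
    refine mul_le_mul (Finset.prod_le_prod (fun j _ => pmf1_nonneg h0 h1 M _)
      (fun j _ => pmf1_le h0 h1 M _)) (hf _) (norm_nonneg _)
      (Finset.prod_nonneg fun j _ => (zpow_pos h0 _).le)

end VG

namespace VG

noncomputable def Gr (d : ℕ) (t : ℝ) (f : (Fin d → ℤ) → ℝ) (x : Fin d → ℤ) : ℝ :=
  ∑' n : Fin d → ℤ, gauss d t n * f (x - n)

lemma exp_q (t : ℝ) (k : ℤ) : Real.exp (-π / t) ^ (k^2) = Real.exp (-π * (k:ℝ)^2 / t) := by
  rw [← Real.rpow_intCast, ← Real.exp_mul]; congr 1; push_cast; ring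

lemma gauss_eq (d : ℕ) (t : ℝ) (n : Fin d → ℤ) : gauss d t n =
    ∏ j, ((∑' k : ℤ, Real.exp (-π / t) ^ (k^2))⁻¹ * Real.exp (-π / t) ^ ((n j)^2)) := by
  rw [Finset.prod_mul_distrib, Finset.prod_inv_distrib]
  unfold gauss bigTheta theta
  congr 1
  · congr 1
    refine Finset.prod_congr rfl fun j _ => tsum_congr fun k => ?_
    rw [exp_q]; congr 1; simp; ring
  · simp only [exp_q]
    rw [← Real.exp_sum]; congr 1
    rw [Finset.mul_sum, Finset.sum_div]

lemma q_pos (t : ℝ) : 0 < Real.exp (-π / t) := Real.exp_pos _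

lemma q_lt {t : ℝ} (ht : 0 < t) : Real.exp (-π / t) < 1 := by
  rw [Real.exp_lt_one_iff]; exact div_neg_of_neg_of_pos (by linarith [Real.pi_pos]) ht

lemma q_mono {t t' : ℝ} (ht : 0 < t) (h : t ≤ t') : Real.exp (-π / t) ≤ Real.exp (-π / t') := by
  rw [Real.exp_le_exp, neg_div, neg_div, neg_le_neg_iff]
  exact div_le_div_of_nonneg_left Real.pi_pos.le ht h

lemma gauss_nonneg (d : ℕ) (t : ℝ) (n : Fin d → ℤ) : 0 ≤ gauss d t n := by
  rw [gauss_eq]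
  refine Finset.prod_nonneg fun j _ => mul_nonneg (inv_nonneg.2 (tsum_nonneg fun k => ?_)) ?_
  · exact (zpow_pos (q_pos t) _).le
  · exact (zpow_pos (q_pos t) _).le

lemma gauss_summable (d : ℕ) {t : ℝ} (ht : 0 < t) : Summable (gauss d t) := by
  have hc : 0 ≤ (∑' k : ℤ, Real.exp (-π / t) ^ (k^2))⁻¹ :=
    inv_nonneg.2 (tsum_nonneg fun k => (zpow_pos (q_pos t) _).le)
  have he : gauss d t = fun n => ∏ j, ((∑' k : ℤ, Real.exp (-π / t) ^ (k^2))⁻¹ *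
    Real.exp (-π / t) ^ ((n j)^2)) := funext (gauss_eq d t)
  rw [he]
  generalize (∑' k : ℤ, Real.exp (-π / t) ^ (k^2))⁻¹ = c at hc
  exact summable_pi_prod (fun m : ℤ => c * Real.exp (-π / t) ^ (m^2))
    (fun m => mul_nonneg hc (zpow_pos (q_pos t) (m^2)).le)
    ((summable_sq (q_pos t) (q_lt ht)).mul_left c) d

lemma gauss_neg (d : ℕ) (t : ℝ) (n : Fin d → ℤ) : gauss d t (-n) = gauss d t n := by
  simp [gauss]

lemma Gr_hasSum (d : ℕ) {t : ℝ} (ht : 0 < t) (f : (Fin d → ℤ) → ℝ) (c : ℝ)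
    (hf : ∀ x, |f x| ≤ c) (x : Fin d → ℤ) :
    HasSum (fun n : Fin d → ℤ => gauss d t n * f (x - n)) (Gr d t f x) := by
  refine Summable.hasSum ?_
  refine Summable.of_norm_bounded ((gauss_summable d ht).mul_right c) fun n => ?_
  rw [norm_mul, Real.norm_of_nonneg (gauss_nonneg d t n)]
  exact mul_le_mul_of_nonneg_left (hf _) (gauss_nonneg d t n)

lemma Tav_Gr (d : ℕ) {t : ℝ} (ht : 0 < t) (f : (Fin d → ℤ) → ℝ) (c : ℝ)
    (hf : ∀ x, |f x| ≤ c) (y : Fin d → ℤ) :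
    Filter.Tendsto (fun M : ℕ => Tav (M := M) (etq (Real.exp (-π / t))) f y) Filter.atTop
      (nhds (Gr d t f y)) := by
  have := Tav_lim (q_pos t) (q_lt ht) d f c hf y
  simp only [← gauss_eq] at this
  have e : Gr d t f y = ∑' n, gauss d t n * f (y + n) := by
    unfold Gr
    rw [← Equiv.tsum_eq (Equiv.neg (Fin d → ℤ))]
    simp [gauss_neg]
  rw [e]; exact this

lemma times (T : Finset ℝ) (hT : ∀ t ∈ T, 0 < t) : ∃ (N : ℕ) (τ : ℕ → ℝ), Monotone τ ∧
    (∀ i, 0 < τ i) ∧ ∀ t ∈ T, ∃ i, 1 ≤ i ∧ i ≤ N ∧ τ i = t := by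
  rcases T.eq_empty_or_nonempty with h | h
  · exact ⟨0, fun _ => 1, monotone_const, fun _ => one_pos, by simp [h]⟩
  · have hc : 0 < T.card := Finset.card_pos.2 h
    refine ⟨T.card, fun i => T.orderEmbOfFin rfl ⟨min (i-1) (T.card-1), by omega⟩, ?_, ?_, ?_⟩
    · intro a b hab
      refine (T.orderEmbOfFin rfl).monotone ?_
      simp only [Fin.mk_le_mk]; omega
    · intro i; exact hT _ (Finset.orderEmbOfFin_mem _ _ _)
    · intro t ht
      have : t ∈ Set.range (T.orderEmbOfFin rfl) := by rw [Finset.range_orderEmbOfFin]; exact ht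
      obtain ⟨k, hk⟩ := this
      refine ⟨k+1, by omega, by omega, ?_⟩
      rw [← hk]
      have hk' : (⟨min ((k:ℕ)+1-1) (T.card-1), by omega⟩ : Fin T.card) = k := by
        apply Fin.ext; simp; omega
      simp only [hk']

theorem fin_var {p r : ℝ} (hp : 1 < p) (hr : 2 < r) : ∃ C : ℝ, 0 < C ∧
    ∀ (d : ℕ) (f : (Fin d → ℤ) → ℝ) (c : ℝ), (∀ x, 0 ≤ f x) → (∀ x, |f x| ≤ c) →
    ∀ (S0 : Finset (Fin d → ℤ)) (J : (Fin d → ℤ) → ℕ) (u : ∀ y, Fin (J y + 1) → ℝ),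
    (∀ y, StrictMono (u y)) → (∀ y j, 0 < u y j) →
    ∑ y ∈ S0, ENNReal.ofReal
      ((∑ j : Fin (J y), |Gr d (u y j.succ) f y - Gr d (u y j.castSucc) f y|^r)^(p/r))
      ≤ ENNReal.ofReal C * ∑' z, ENNReal.ofReal (f z ^ p) := by
  obtain ⟨C, hC, hG⟩ := cube_transfer hp hr
  refine ⟨C, hC, ?_⟩
  intro d f c hf hfc S0 J u hu hu0
  have hr0 : 0 < r := by linarith
  have hpr : 0 < p / r := by positivity
  obtain ⟨N, τ, hτm, hτ0, hτ⟩ := times (S0.biUnion fun y => Finset.univ.image (u y)) (by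
    intro t ht
    simp only [Finset.mem_biUnion, Finset.mem_image, Finset.mem_univ, true_and] at ht
    obtain ⟨y, _, j, rfl⟩ := ht
    exact hu0 y j)
  have hv : ∀ y ∈ S0, ∀ j, ∃ i, 1 ≤ i ∧ i ≤ N ∧ τ i = u y j := by
    intro y hy j
    refine hτ _ ?_
    simp only [Finset.mem_biUnion, Finset.mem_image, Finset.mem_univ, true_and]
    exact ⟨y, hy, j, rfl⟩
  let η : ℕ → ℕ → ℝ := fun i m => if i = 0 then 0 else etq (Real.exp (-π / τ i)) m
  have hη : ∀ M : ℕ, ∑ y ∈ S0, ENNReal.ofReal ((∑ j : Fin (J y),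
      |Tav (M := M) (etq (Real.exp (-π / u y j.succ))) f y -
        Tav (M := M) (etq (Real.exp (-π / u y j.castSucc))) f y|^r)^(p/r))
      ≤ ENNReal.ofReal C * ∑' z, ENNReal.ofReal (f z ^ p) := by
    intro M
    obtain ⟨B, hB0, hBv, hBp⟩ := hG d M N η f (fun k => by simp [η])
      (fun i k => by
        simp only [η]; split_ifs
        · exact le_rfl
        · exact etq_nonneg (q_pos _) _)
      (fun i k => by
        simp only [η]; split_ifs
        · norm_num
        · exact etq_lt (q_pos _) (q_lt (hτ0 _)) _)
      (fun i k => by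
        simp only [η, Nat.succ_ne_zero, if_false]; split_ifs
        · exact etq_nonneg (q_pos _) _
        · exact etq_mono (q_pos _) (q_mono (hτ0 _) (hτm (Nat.le_succ i))) _) hf
    refine le_trans ?_ hBp
    refine le_trans ?_ (ENNReal.sum_le_tsum S0)
    refine Finset.sum_le_sum fun y hy => ENNReal.ofReal_le_ofReal ?_
    choose v hv1 hvN hvτ using hv y hy
    have hvm : StrictMono v := by
      intro a b hab
      by_contra hcon
      push Not at hcon
      have h1 := hτm hcon
      rw [hvτ, hvτ] at h1
      exact absurd (hu y hab) (not_lt.2 h1)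
    have hb := hBv y (J y) v hvm hvN
    have hη' : ∀ j, η (v j) = etq (Real.exp (-π / u y j)) := by
      intro j; funext m
      have : v j ≠ 0 := by have := hv1 j; omega
      simp only [η, this, if_false, hvτ]
    simp only [hη'] at hb
    calc _ ≤ (B y ^ r)^(p/r) := Real.rpow_le_rpow (Finset.sum_nonneg fun j _ =>
            Real.rpow_nonneg (abs_nonneg _) _) hb hpr.le
      _ = B y ^ p := by rw [← Real.rpow_mul (hB0 y)]; congr 1; field_simp
  refine le_of_tendsto' (x := Filter.atTop) ?_ hη
  refine tendsto_finsetSum _ fun y _ => ?_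
  refine ENNReal.tendsto_ofReal ?_
  refine Filter.Tendsto.rpow_const ?_ (Or.inr hpr.le)
  refine tendsto_finsetSum _ fun j _ => ?_
  refine Filter.Tendsto.rpow_const ?_ (Or.inr hr0.le)
  exact ((Tav_Gr d (hu0 y _) f c hfc y).sub (Tav_Gr d (hu0 y _) f c hfc y)).abs

lemma four_rpow {s : ℝ} (hs : 0 < s) (x : Fin 4 → ℝ) (hx : ∀ i, 0 ≤ x i) :
    (∑ i, x i)^s ≤ 4^s * ∑ i, x i ^ s := by
  obtain ⟨i0, -, h⟩ := Finset.exists_max_image Finset.univ x ⟨0, Finset.mem_univ _⟩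
  have h1 : ∑ i, x i ≤ 4 * x i0 := by
    have := Finset.sum_le_card_nsmul Finset.univ x (x i0) h
    simpa using this
  calc (∑ i, x i)^s ≤ (4 * x i0)^s := Real.rpow_le_rpow (Finset.sum_nonneg fun i _ => hx i) h1 hs.le
    _ = 4^s * x i0 ^ s := Real.mul_rpow (by norm_num) (hx i0)
    _ ≤ _ := by
      refine mul_le_mul_of_nonneg_left ?_ (by positivity)
      exact Finset.single_le_sum (f := fun i => x i ^ s) (fun i _ => Real.rpow_nonneg (hx i) _)
        (Finset.mem_univ i0)

noncomputable def part (z : ℂ) : Fin 4 → ℝ := ![max z.re 0, max (-z.re) 0, max z.im 0, max (-z.im) 0]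

lemma part_nonneg (z : ℂ) (i : Fin 4) : 0 ≤ part z i := by
  fin_cases i <;> simp [part]

lemma part_le (z : ℂ) (i : Fin 4) : part z i ≤ ‖z‖ := by
  have h1 := Complex.abs_re_le_norm z
  have h2 := Complex.abs_im_le_norm z
  have h3 := le_abs_self z.re
  have h4 := neg_le_abs z.re
  have h5 := le_abs_self z.im
  have h6 := neg_le_abs z.im
  have h7 := norm_nonneg z
  fin_cases i <;> simp [part] <;> linarith

lemma part_eq (z : ℂ) : z = ((part z 0 : ℂ) - part z 1) + ((part z 2 : ℂ) - part z 3) * Complex.I := by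
  have hm : ∀ a : ℝ, max a 0 - max (-a) 0 = a := by
    intro a; rcases le_total a 0 with h | h
    · rw [max_eq_right h, max_eq_left (by linarith)]; ring
    · rw [max_eq_left h, max_eq_right (by linarith)]; ring
  apply Complex.ext
  · simp [part, hm]
  · simp [part, hm]

lemma gConv_eq (d : ℕ) {t : ℝ} (ht : 0 < t) (f : (Fin d → ℤ) → ℂ) (c : ℝ)
    (hf : ∀ x, ‖f x‖ ≤ c) (x : Fin d → ℤ) :
    gConv d t f x = ((Gr d t (fun y => part (f y) 0) x : ℂ) - Gr d t (fun y => part (f y) 1) x) +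
      ((Gr d t (fun y => part (f y) 2) x : ℂ) - Gr d t (fun y => part (f y) 3) x) * Complex.I := by
  have H := fun i : Fin 4 => Complex.hasSum_ofReal.2 (Gr_hasSum d ht (fun y => part (f y) i) c (fun y => by
    rw [abs_of_nonneg (part_nonneg _ _)]; exact (part_le _ _).trans (hf y)) x)
  have h := ((H 0).sub (H 1)).add (((H 2).sub (H 3)).mul_right Complex.I)
  unfold gConv
  rw [← h.tsum_eq]
  refine tsum_congr fun n => ?_
  conv_lhs => rw [part_eq (f (x - n))]
  push_cast
  ring

lemma norm_four (a b : Fin 4 → ℝ) : ‖((((a 0 : ℂ) - a 1) + ((a 2 : ℂ) - a 3) * Complex.I) -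
    (((b 0 : ℂ) - b 1) + ((b 2 : ℂ) - b 3) * Complex.I))‖ ≤ ∑ i, |a i - b i| := by
  have e : ((((a 0 : ℂ) - a 1) + ((a 2 : ℂ) - a 3) * Complex.I) -
    (((b 0 : ℂ) - b 1) + ((b 2 : ℂ) - b 3) * Complex.I)) =
    ((a 0 - b 0 : ℝ) : ℂ) - ((a 1 - b 1 : ℝ) : ℂ) + (((a 2 - b 2 : ℝ) : ℂ) * Complex.I -
      ((a 3 - b 3 : ℝ) : ℂ) * Complex.I) := by push_cast; ring
  rw [e]
  refine (norm_add_le _ _).trans ?_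
  have h1 := norm_sub_le ((a 0 - b 0 : ℝ) : ℂ) ((a 1 - b 1 : ℝ) : ℂ)
  have h2 := norm_sub_le (((a 2 - b 2 : ℝ) : ℂ) * Complex.I) (((a 3 - b 3 : ℝ) : ℂ) * Complex.I)
  rw [norm_mul, norm_mul, Complex.norm_I, mul_one, mul_one] at h2
  simp only [Complex.norm_real, Real.norm_eq_abs] at h1 h2
  rw [Fin.sum_univ_four]
  linarith

theorem fin_var_c {p r : ℝ} (hp : 1 < p) (hr : 2 < r) : ∃ C : ℝ, 0 < C ∧
    ∀ (d : ℕ) (f : (Fin d → ℤ) → ℂ) (c : ℝ), (∀ x, ‖f x‖ ≤ c) →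
    ∀ (S0 : Finset (Fin d → ℤ)) (J : (Fin d → ℤ) → ℕ) (u : ∀ y, Fin (J y + 1) → ℝ),
    (∀ y, StrictMono (u y)) → (∀ y j, 0 < u y j) →
    ∑ y ∈ S0, ENNReal.ofReal
      ((∑ j : Fin (J y), ‖gConv d (u y j.succ) f y - gConv d (u y j.castSucc) f y‖^r)^(p/r))
      ≤ ENNReal.ofReal C * ∑' z, ENNReal.ofReal (‖f z‖ ^ p) := by
  obtain ⟨C, hC, hG⟩ := fin_var hp hr
  have hr0 : 0 < r := by linarith
  have hpr : 0 < p / r := by positivity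
  set c4 : ℝ := 4^(p/r) * ((4^r)^(p/r)) with hc4
  have hc40 : 0 < c4 := by positivity
  refine ⟨c4 * (4 * C), by positivity, ?_⟩
  intro d f c hf S0 J u hu hu0
  have H := fun i : Fin 4 => hG d (fun y => part (f y) i) c (fun y => part_nonneg _ _) (fun y => by
    rw [abs_of_nonneg (part_nonneg _ _)]; exact (part_le _ _).trans (hf y)) S0 J u hu hu0
  have hle : ∀ i : Fin 4, ∑' z, ENNReal.ofReal (part (f z) i ^ p) ≤ ∑' z, ENNReal.ofReal (‖f z‖ ^ p) :=
    fun i => ENNReal.tsum_le_tsum fun z => ENNReal.ofReal_le_ofReal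
      (Real.rpow_le_rpow (part_nonneg _ _) (part_le _ _) (by linarith))
  have key : ∀ y, (∑ j : Fin (J y), ‖gConv d (u y j.succ) f y - gConv d (u y j.castSucc) f y‖^r)^(p/r)
      ≤ c4 * ∑ i : Fin 4, (∑ j : Fin (J y), |Gr d (u y j.succ) (fun y => part (f y) i) y -
        Gr d (u y j.castSucc) (fun y => part (f y) i) y|^r)^(p/r) := by
    intro y
    have h1 : ∑ j : Fin (J y), ‖gConv d (u y j.succ) f y - gConv d (u y j.castSucc) f y‖^r ≤
        4^r * ∑ i : Fin 4, ∑ j : Fin (J y), |Gr d (u y j.succ) (fun y => part (f y) i) y -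
        Gr d (u y j.castSucc) (fun y => part (f y) i) y|^r := by
      rw [Finset.sum_comm, Finset.mul_sum]
      refine Finset.sum_le_sum fun j _ => ?_
      rw [gConv_eq d (hu0 y _) f c hf, gConv_eq d (hu0 y _) f c hf]
      refine le_trans (Real.rpow_le_rpow (norm_nonneg _) (norm_four
        (fun i => Gr d (u y j.succ) (fun y => part (f y) i) y)
        (fun i => Gr d (u y j.castSucc) (fun y => part (f y) i) y)) hr0.le) ?_
      exact four_rpow hr0 _ (fun i => abs_nonneg _)
    have hnn : ∀ i : Fin 4, 0 ≤ ∑ j : Fin (J y), |Gr d (u y j.succ) (fun y => part (f y) i) y -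
        Gr d (u y j.castSucc) (fun y => part (f y) i) y|^r := fun i =>
      Finset.sum_nonneg fun j _ => Real.rpow_nonneg (abs_nonneg _) _
    refine le_trans (Real.rpow_le_rpow (Finset.sum_nonneg fun j _ =>
      Real.rpow_nonneg (norm_nonneg _) _) h1 hpr.le) ?_
    rw [Real.mul_rpow (by positivity) (Finset.sum_nonneg fun i _ => hnn i)]
    have h2 := four_rpow hpr _ hnn
    calc _ ≤ (4^r)^(p/r) * _ := mul_le_mul_of_nonneg_left h2 (by positivity)
      _ = _ := by rw [hc4]; ring
  have nn2 : ∀ y (i : Fin 4), 0 ≤ (∑ j : Fin (J y), |Gr d (u y j.succ) (fun y => part (f y) i) y -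
        Gr d (u y j.castSucc) (fun y => part (f y) i) y|^r)^(p/r) := fun y i =>
      Real.rpow_nonneg (Finset.sum_nonneg fun j _ => Real.rpow_nonneg (abs_nonneg _) _) _
  calc _ ≤ ∑ y ∈ S0, ENNReal.ofReal c4 * ∑ i : Fin 4, ENNReal.ofReal ((∑ j : Fin (J y),
          |Gr d (u y j.succ) (fun y => part (f y) i) y -
        Gr d (u y j.castSucc) (fun y => part (f y) i) y|^r)^(p/r)) := by
        refine Finset.sum_le_sum fun y _ => ?_
        rw [← ENNReal.ofReal_sum_of_nonneg (fun i _ => nn2 y i), ← ENNReal.ofReal_mul hc40.le]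
        exact ENNReal.ofReal_le_ofReal (key y)
    _ = ENNReal.ofReal c4 * ∑ i : Fin 4, ∑ y ∈ S0, ENNReal.ofReal ((∑ j : Fin (J y),
          |Gr d (u y j.succ) (fun y => part (f y) i) y -
        Gr d (u y j.castSucc) (fun y => part (f y) i) y|^r)^(p/r)) := by
        rw [← Finset.mul_sum, Finset.sum_comm]
    _ ≤ ENNReal.ofReal c4 * ∑ i : Fin 4, ENNReal.ofReal C * ∑' z, ENNReal.ofReal (‖f z‖ ^ p) := by
        gcongr with i
        exact (H i).trans (mul_le_mul_right (hle i) _)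
    _ = _ := by
        rw [Finset.sum_const, Finset.card_univ, Fintype.card_fin, nsmul_eq_mul,
          ENNReal.ofReal_mul hc40.le, ENNReal.ofReal_mul (by norm_num : (0:ℝ) ≤ 4)]
        simp [mul_assoc]

lemma sup_step {X I : Type*} [Nonempty I] (g : X → I → ℝ≥0∞) (R : ℝ≥0∞) (S0 : Finset X) :
    ∀ k : ℝ≥0∞, (∀ c : X → I, ∑ x ∈ S0, g x (c x) + k ≤ R) → ∑ x ∈ S0, (⨆ i, g x i) + k ≤ R := by
  classical
  induction S0 using Finset.induction_on with
  | empty => intro k h; simpa using h (fun _ => Classical.arbitrary I)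
  | insert a s ha ih =>
    intro k h
    rw [Finset.sum_insert ha, add_assoc, ENNReal.iSup_add]
    refine iSup_le fun i => ?_
    rw [add_left_comm]
    refine ih (g a i + k) fun c => ?_
    have := h (Function.update c a i)
    rw [Finset.sum_insert ha, Function.update_self] at this
    rw [← add_assoc, add_comm _ (g a i)]
    refine le_trans (le_of_eq ?_) this
    congr 2
    refine Finset.sum_congr rfl fun x hx => ?_
    rw [Function.update_of_ne (fun hxa : x = a => ha (hxa ▸ hx))]

abbrev Seqs := Σ J : ℕ, {u : Fin (J+1) → ℝ // StrictMono u ∧ ∀ j, 0 < u j}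

lemma le_one_div_iff {p : ℝ} (hp : 0 < p) {x y : ℝ≥0∞} : x ≤ y^(1/p) ↔ x^p ≤ y := by
  rw [one_div, ENNReal.le_rpow_inv_iff hp]

lemma var_le {p r : ℝ} (hp : 0 < p) (hr : 0 < r) (a : ℝ → ℂ) :
    variationSeminorm a (Set.Ioi 0) r ^ p ≤ ⨆ i : Seqs, ENNReal.ofReal
      ((∑ j : Fin i.1, ‖a (i.2.1 j.succ) - a (i.2.1 j.castSucc)‖^r)^(p/r)) := by
  rw [← le_one_div_iff hp]
  unfold variationSeminorm
  refine iSup_le fun J => iSup_le fun u => iSup_le fun hu => iSup_le fun hu0 => ?_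
  rw [le_one_div_iff hp]
  refine le_trans (le_of_eq ?_) (le_iSup _ (⟨J, u, hu, hu0⟩ : Seqs))
  have e : ∀ j : Fin J, (‖a (u j.succ) - a (u j.castSucc)‖₊ : ℝ≥0∞) ^ r =
      ENNReal.ofReal (‖a (u j.succ) - a (u j.castSucc)‖^r) := by
    intro j
    rw [← ENNReal.ofReal_rpow_of_nonneg (norm_nonneg _) hr.le, ofReal_norm]; rfl
  simp only [e]
  have nn : 0 ≤ ∑ j : Fin J, ‖a (u j.succ) - a (u j.castSucc)‖^r :=
    Finset.sum_nonneg fun j _ => Real.rpow_nonneg (norm_nonneg _) _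
  rw [← ENNReal.ofReal_sum_of_nonneg (fun j _ => Real.rpow_nonneg (norm_nonneg _) _),
    ← ENNReal.rpow_mul, ENNReal.ofReal_rpow_of_nonneg nn (by positivity)]
  congr 2
  ring

end VG

/-- Dimension-free ℓ^p r-variational inequality for the discrete Gaussian family `G_t`: for each
`p ∈ (1,∞)` and `r ∈ (2,∞)` there is `C_{p,r} > 0`, independent of the dimension `d`, with
`‖V^r(G_t f : t>0)‖_{ℓ^p} ≤ C_{p,r} ‖f‖_{ℓ^p}` for all `f ∈ ℓ^p(ℤ^d)`. -/
theorem variation_gauss_dimension_free (p : ℝ) (hp : 1 < p) (r : ℝ) (hr : 2 < r) :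
    ∃ C : ℝ, 0 < C ∧ ∀ d : ℕ, 0 < d → ∀ f : (Fin d → ℤ) → ℂ,
      lpNorm d p (fun x => (‖f x‖₊ : ℝ≥0∞)) < ⊤ →
      lpNorm d p (fun x => variationSeminorm (fun t => gConv d t f x) (Set.Ioi 0) r)
        ≤ ENNReal.ofReal C * lpNorm d p (fun x => (‖f x‖₊ : ℝ≥0∞)) := by
  obtain ⟨C, hC, hG⟩ := VG.fin_var_c hp hr
  have hp0 : 0 < p := by linarith
  have hr0 : 0 < r := by linarith
  refine ⟨C^(1/p), by positivity, ?_⟩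
  intro d _ f hf
  have hb : ∀ x, ‖f x‖ ≤ (lpNorm d p (fun x => (‖f x‖₊ : ℝ≥0∞))).toReal := by
    intro x
    have h1 : (‖f x‖₊ : ℝ≥0∞) ≤ lpNorm d p (fun x => (‖f x‖₊ : ℝ≥0∞)) := by
      unfold lpNorm
      rw [VG.le_one_div_iff hp0]
      exact ENNReal.le_tsum (f := fun x => (‖f x‖₊ : ℝ≥0∞) ^ p) x
    have := ENNReal.toReal_mono hf.ne h1
    simpa using this
  have e : ∀ z, (‖f z‖₊ : ℝ≥0∞)^p = ENNReal.ofReal (‖f z‖^p) := by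
    intro z
    rw [← ENNReal.ofReal_rpow_of_nonneg (norm_nonneg _) hp0.le, ofReal_norm]; rfl
  unfold lpNorm at hb ⊢
  have main : ∑' x, variationSeminorm (fun t => gConv d t f x) (Set.Ioi 0) r ^ p ≤
      ENNReal.ofReal C * ∑' z, (‖f z‖₊ : ℝ≥0∞)^p := by
    simp only [e]
    rw [ENNReal.tsum_eq_iSup_sum]
    refine iSup_le fun S0 => ?_
    refine le_trans (Finset.sum_le_sum fun x _ => VG.var_le hp0 hr0 _) ?_
    have : Nonempty VG.Seqs := ⟨⟨0, fun _ => 1, fun a b h => by omega, fun _ => one_pos⟩⟩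
    have := VG.sup_step (fun x (i : VG.Seqs) => ENNReal.ofReal
      ((∑ j : Fin i.1, ‖gConv d (i.2.1 j.succ) f x - gConv d (i.2.1 j.castSucc) f x‖^r)^(p/r)))
      (ENNReal.ofReal C * ∑' z, ENNReal.ofReal (‖f z‖ ^ p)) S0 0 (fun c => by
        rw [add_zero]
        exact hG d f _ hb S0 (fun y => (c y).1) (fun y => (c y).2.1) (fun y => (c y).2.2.1)
          (fun y => (c y).2.2.2))
    simpa using this
  refine le_trans (ENNReal.rpow_le_rpow main (by positivity)) ?_
  rw [ENNReal.mul_rpow_of_nonneg _ _ (by positivity), ENNReal.ofReal_rpow_of_nonneg hC.le (by positivity)]
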